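/- Every Dirichlet eigenvalue of the equilateral triangle of side 1 is also a Dirichlet eigenvalue of the 6-regular star (hexagram): if λ is a Dirichlet eigenvalue of the open triangle with vertices (0,0), (1,0), (1/2, √3/2), then λ is a Dirichlet eigenvalue of the open hexagram S defined as the union of the two open equilateral triangles of side 3 centered at the origin, the first with vertices √3·(cos(π/2 + 2kπ/3), sin(π/2 + 2kπ/3)) for k = 0,1,2 and the second its image under the map p ↦ −p. -/

import Mathlib

/-- The planar Laplacian `∂²u/∂x² + ∂²u/∂y²` of `u : ℝ × ℝ → ℝ` at a point `p`. -/
noncomputable def lap2 (u : ℝ × ℝ → ℝ) (p : ℝ × ℝ) : ℝ :=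
  deriv (deriv fun x => u (x, p.2)) p.1 + deriv (deriv fun y => u (p.1, y)) p.2

/-- `lam` is a Dirichlet eigenvalue of the bounded open set `Ω ⊆ ℝ²`. -/
def IsDirichletEigenvalue (Ω : Set (ℝ × ℝ)) (lam : ℝ) : Prop :=
  ∃ u : ℝ × ℝ → ℝ,
    ContinuousOn u (closure Ω) ∧
    ContDiffOn ℝ 2 u Ω ∧
    (∀ p ∈ frontier Ω, u p = 0) ∧
    (∃ p ∈ Ω, u p ≠ 0) ∧
    (∀ p ∈ Ω, lap2 u p = -lam * u p)

/-- The open equilateral triangle with vertices `(0,0)`, `(1,0)`, `(1/2, √3/2)`. -/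
noncomputable def equilateralTriangle : Set (ℝ × ℝ) :=
  interior (convexHull ℝ {((0 : ℝ), (0 : ℝ)), ((1 : ℝ), (0 : ℝ)),
    ((1 / 2 : ℝ), (Real.sqrt 3 / 2 : ℝ))})

/-- The closed equilateral triangle of side 3 with vertices
`√3·(cos(π/2 + 2kπ/3), sin(π/2 + 2kπ/3))`, `k = 0,1,2`. -/
noncomputable def starTriangle : Set (ℝ × ℝ) :=
  convexHull ℝ (Set.range fun k : Fin 3 =>
    ((Real.sqrt 3 * Real.cos (Real.pi / 2 + 2 * k * Real.pi / 3),
      Real.sqrt 3 * Real.sin (Real.pi / 2 + 2 * k * Real.pi / 3)) : ℝ × ℝ))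

/-- The open hexagram: the union of the interiors of the two closed equilateral
triangles of side 3, the second being the image of the first under `p ↦ -p`. -/
noncomputable def hexagram : Set (ℝ × ℝ) :=
  interior starTriangle ∪ interior ((fun p : ℝ × ℝ => -p) '' starTriangle)


section Green
open MeasureTheory Set Filter Topology

theorem integrable_mul_of_tsupport {Ω : Set (ℝ × ℝ)} {f g : ℝ × ℝ → ℝ} (hf : ContinuousOn f Ω)
    (hg : Continuous g) (hc : HasCompactSupport g) (hs : tsupport g ⊆ Ω) :
    Integrable (fun x => f x * g x) := by
  rw [← integrableOn_iff_integrable_of_support_subset (s := tsupport g)]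
  · exact ((hf.mono hs).mul hg.continuousOn).integrableOn_compact hc
  · intro x hx
    apply subset_tsupport
    intro h
    apply hx
    simp [h]

theorem ibp_dir {Ω : Set (ℝ × ℝ)} (hΩ : IsOpen Ω) {u ψ : ℝ × ℝ → ℝ} (v : ℝ × ℝ)
    (hu : ContDiffOn ℝ 2 u Ω) (hψ : ContDiff ℝ 2 ψ) (hc : HasCompactSupport ψ)
    (hs : tsupport ψ ⊆ Ω) :
    ∫ p, u p * fderiv ℝ (fun q => fderiv ℝ ψ q v) p v =
      ∫ p, fderiv ℝ (fun q => fderiv ℝ u q v) p v * ψ p := by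
  have hψ1 : ContDiff ℝ 1 (fun q => fderiv ℝ ψ q v) :=
    (hψ.fderiv_right (m := 1) (by norm_num)).clm_apply contDiff_const
  have hψ2 : Continuous (fun p => fderiv ℝ (fun q => fderiv ℝ ψ q v) p v) :=
    (hψ1.continuous_fderiv (by norm_num)).clm_apply continuous_const
  have hu1 : ContDiffOn ℝ 1 (fun q => fderiv ℝ u q v) Ω :=
    (hu.fderiv_of_isOpen hΩ (m := 1) (by norm_num)).clm_apply contDiffOn_const
  have hu2 : ContinuousOn (fun p => fderiv ℝ (fun q => fderiv ℝ u q v) p v) Ω :=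
    (hu1.continuousOn_fderiv_of_isOpen hΩ (by norm_num)).clm_apply continuousOn_const
  have hc1 : HasCompactSupport (fun q => fderiv ℝ ψ q v) := hc.fderiv_apply (𝕜 := ℝ) v
  have hc2 : HasCompactSupport (fun p => fderiv ℝ (fun q => fderiv ℝ ψ q v) p v) :=
    hc1.fderiv_apply (𝕜 := ℝ) v
  have hs1 : tsupport (fun q => fderiv ℝ ψ q v) ⊆ Ω := (tsupport_fderiv_apply_subset ℝ v).trans hs
  have hs2 : tsupport (fun p => fderiv ℝ (fun q => fderiv ℝ ψ q v) p v) ⊆ Ω :=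
    (tsupport_fderiv_apply_subset ℝ v).trans hs1
  have e1 := integral_mul_fderiv_eq_neg_fderiv_mul_of_integrable (μ := volume)
    (f := u) (g := fun q => fderiv ℝ ψ q v) (v := v)
    (integrable_mul_of_tsupport hu1.continuousOn hψ1.continuous hc1 hs1)
    (integrable_mul_of_tsupport hu.continuousOn hψ2 hc2 hs2)
    (integrable_mul_of_tsupport hu.continuousOn hψ1.continuous hc1 hs1)
    (fun x hx => (hu.contDiffAt (hΩ.mem_nhds (hs1 hx))).differentiableAt (by norm_num))
    (fun x _ => (hψ1.differentiable (by norm_num)) x)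
  have e2 := integral_mul_fderiv_eq_neg_fderiv_mul_of_integrable (μ := volume)
    (f := fun q => fderiv ℝ u q v) (g := ψ) (v := v)
    (integrable_mul_of_tsupport hu2 hψ.continuous hc hs)
    (integrable_mul_of_tsupport hu1.continuousOn hψ1.continuous hc1 hs1)
    (integrable_mul_of_tsupport hu1.continuousOn hψ.continuous hc hs)
    (fun x hx => (hu1.contDiffAt (hΩ.mem_nhds (hs hx))).differentiableAt (by norm_num))
    (fun x _ => (hψ.differentiable (by norm_num)) x)
  rw [e1, e2, neg_neg]

theorem deriv_slice_fst {u : ℝ × ℝ → ℝ} {p : ℝ × ℝ} (h : DifferentiableAt ℝ u p) :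
    deriv (fun x => u (x, p.2)) p.1 = fderiv ℝ u p (1, 0) := by
  have : HasDerivAt (fun x : ℝ => ((x, p.2) : ℝ × ℝ)) (1, 0) p.1 :=
    (hasDerivAt_id p.1).prodMk (hasDerivAt_const _ _)
  exact (h.hasFDerivAt.comp_hasDerivAt p.1 (f := fun x : ℝ => ((x, p.2) : ℝ × ℝ)) this).deriv

theorem deriv_slice_snd {u : ℝ × ℝ → ℝ} {p : ℝ × ℝ} (h : DifferentiableAt ℝ u p) :
    deriv (fun y => u (p.1, y)) p.2 = fderiv ℝ u p (0, 1) := by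
  have : HasDerivAt (fun y : ℝ => ((p.1, y) : ℝ × ℝ)) (0, 1) p.2 :=
    (hasDerivAt_const _ _).prodMk (hasDerivAt_id p.2)
  exact (h.hasFDerivAt.comp_hasDerivAt p.2 (f := fun y : ℝ => ((p.1, y) : ℝ × ℝ)) this).deriv

theorem lap2_eq {Ω : Set (ℝ × ℝ)} (hΩ : IsOpen Ω) {u : ℝ × ℝ → ℝ} (hu : ContDiffOn ℝ 2 u Ω)
    {p : ℝ × ℝ} (hp : p ∈ Ω) :
    lap2 u p = fderiv ℝ (fun q => fderiv ℝ u q (1, 0)) p (1, 0) +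
      fderiv ℝ (fun q => fderiv ℝ u q (0, 1)) p (0, 1) := by
  have hd : ∀ q ∈ Ω, DifferentiableAt ℝ u q := fun q hq =>
    (hu.contDiffAt (hΩ.mem_nhds hq)).differentiableAt (by norm_num)
  have hd1 : ∀ v, DifferentiableAt ℝ (fun q => fderiv ℝ u q v) p := fun v =>
    (((hu.fderiv_of_isOpen hΩ (m := 1) (by norm_num)).clm_apply
      (contDiffOn_const (c := v))).contDiffAt (hΩ.mem_nhds hp)).differentiableAt (by norm_num)
  unfold lap2
  congr 1
  · rw [← deriv_slice_fst (hd1 _)]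
    apply Filter.EventuallyEq.deriv_eq
    have hc : Continuous (fun x : ℝ => ((x, p.2) : ℝ × ℝ)) := by fun_prop
    filter_upwards [hc.continuousAt.eventually (hΩ.mem_nhds (x := ((p.1, p.2) : ℝ × ℝ)) hp)] with x hx
    exact deriv_slice_fst (p := (x, p.2)) (hd _ hx)
  · rw [← deriv_slice_snd (hd1 _)]
    apply Filter.EventuallyEq.deriv_eq
    have hc : Continuous (fun y : ℝ => ((p.1, y) : ℝ × ℝ)) := by fun_prop
    filter_upwards [hc.continuousAt.eventually (hΩ.mem_nhds (x := ((p.1, p.2) : ℝ × ℝ)) hp)] with x hx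
    exact deriv_slice_snd (p := (p.1, x)) (hd _ hx)

theorem green {Ω : Set (ℝ × ℝ)} (hΩ : IsOpen Ω) {u ψ : ℝ × ℝ → ℝ}
    (hu : ContDiffOn ℝ 2 u Ω) (hψ : ContDiff ℝ 2 ψ) (hc : HasCompactSupport ψ)
    (hs : tsupport ψ ⊆ Ω) :
    ∫ p, u p * lap2 ψ p = ∫ p, lap2 u p * ψ p := by
  have hψ2 : ∀ v, Continuous (fun p => fderiv ℝ (fun q => fderiv ℝ ψ q v) p v) := fun v =>
    (((hψ.fderiv_right (m := 1) (by norm_num)).clm_apply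
      (contDiff_const (c := v))).continuous_fderiv (by norm_num)).clm_apply continuous_const
  have hu2 : ∀ v, ContinuousOn (fun p => fderiv ℝ (fun q => fderiv ℝ u q v) p v) Ω := fun v =>
    (((hu.fderiv_of_isOpen hΩ (m := 1) (by norm_num)).clm_apply
      (contDiffOn_const (c := v))).continuousOn_fderiv_of_isOpen hΩ (by norm_num)).clm_apply
      continuousOn_const
  have hc2 : ∀ v, HasCompactSupport (fun p => fderiv ℝ (fun q => fderiv ℝ ψ q v) p v) := fun v =>
    (hc.fderiv_apply (𝕜 := ℝ) v).fderiv_apply (𝕜 := ℝ) v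
  have hs2 : ∀ v, tsupport (fun p => fderiv ℝ (fun q => fderiv ℝ ψ q v) p v) ⊆ Ω := fun v =>
    (tsupport_fderiv_apply_subset ℝ v).trans ((tsupport_fderiv_apply_subset ℝ v).trans hs)
  have e1 : ∀ p, u p * lap2 ψ p = u p * fderiv ℝ (fun q => fderiv ℝ ψ q (1, 0)) p (1, 0) +
      u p * fderiv ℝ (fun q => fderiv ℝ ψ q (0, 1)) p (0, 1) := fun p => by
    rw [lap2_eq isOpen_univ hψ.contDiffOn (mem_univ p), mul_add]
  have e2 : ∀ p, lap2 u p * ψ p = fderiv ℝ (fun q => fderiv ℝ u q (1, 0)) p (1, 0) * ψ p +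
      fderiv ℝ (fun q => fderiv ℝ u q (0, 1)) p (0, 1) * ψ p := fun p => by
    by_cases hp : p ∈ Ω
    · rw [lap2_eq hΩ hu hp, add_mul]
    · have : ψ p = 0 := image_eq_zero_of_notMem_tsupport (fun h => hp (hs h))
      simp [this]
  simp_rw [e1, e2]
  rw [integral_add (integrable_mul_of_tsupport hu.continuousOn (hψ2 _) (hc2 _) (hs2 _))
    (integrable_mul_of_tsupport hu.continuousOn (hψ2 _) (hc2 _) (hs2 _)),
    integral_add (integrable_mul_of_tsupport (hu2 _) hψ.continuous hc hs)
    (integrable_mul_of_tsupport (hu2 _) hψ.continuous hc hs),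
    ibp_dir hΩ _ hu hψ hc hs, ibp_dir hΩ _ hu hψ hc hs]

end Green

section Geometry
open Set Filter Topology

/-- First barycentric-type coordinate. -/
noncomputable def cs (p : ℝ × ℝ) : ℝ := p.1 - Real.sqrt 3 / 3 * p.2

/-- Second barycentric-type coordinate. -/
noncomputable def cr (p : ℝ × ℝ) : ℝ := 2 * Real.sqrt 3 / 3 * p.2

theorem sqrt3_sq : Real.sqrt 3 * Real.sqrt 3 = 3 := Real.mul_self_sqrt (by norm_num)

theorem continuous_cs : Continuous cs := by unfold cs; fun_prop

theorem continuous_cr : Continuous cr := by unfold cr; fun_prop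

theorem pt_ext {p q : ℝ × ℝ} (h1 : cs p = cs q) (h2 : cr p = cr q) : p = q := by
  unfold cs at h1
  unfold cr at h2
  have h3 : (0 : ℝ) < Real.sqrt 3 := by positivity
  have e2 : p.2 = q.2 := by
    have : (2 * Real.sqrt 3 / 3) * (p.2 - q.2) = 0 := by linarith
    rcases mul_eq_zero.1 this with h | h
    · exfalso; linarith
    · linarith
  rw [e2] at h1
  exact Prod.ext (by linarith) e2

theorem cs_comb (a b c : ℝ) (P Q R : ℝ × ℝ) :
    cs (a • P + b • Q + c • R) = a * cs P + b * cs Q + c * cs R := by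
  simp [cs]; ring

theorem cr_comb (a b c : ℝ) (P Q R : ℝ × ℝ) :
    cr (a • P + b • Q + c • R) = a * cr P + b * cr Q + c * cr R := by
  simp [cr]; ring

theorem mem_hull3 {S : Set (ℝ × ℝ)} {P Q R p : ℝ × ℝ} (hP : P ∈ S) (hQ : Q ∈ S) (hR : R ∈ S)
    {a b c : ℝ} (ha : 0 ≤ a) (hb : 0 ≤ b) (hc : 0 ≤ c) (h : a + b + c = 1)
    (hp : p = a • P + b • Q + c • R) : p ∈ convexHull ℝ S := by
  have hS := convex_convexHull ℝ S
  have := hS.sum_mem (t := Finset.univ) (w := ![a, b, c]) (z := ![P, Q, R])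
    (by intro i _; fin_cases i <;> simpa)
    (by simp [Fin.sum_univ_three, h])
    (by intro i _; fin_cases i <;> simp <;> exact subset_convexHull ℝ S (by assumption))
  rw [hp]
  simpa [Fin.sum_univ_three] using this

theorem convex_ineq (f : ℝ × ℝ → ℝ) (hf : ∀ (a b : ℝ) (p q : ℝ × ℝ), a + b = 1 →
    f (a • p + b • q) = a * f p + b * f q) : Convex ℝ {p | 0 ≤ f p} := by
  intro p hp q hq a b ha hb hab
  simp only [mem_ofPred_eq] at *
  rw [hf a b p q hab]
  positivity

theorem convex_tri (k l m : ℝ) : Convex ℝ {p | k ≤ cs p ∧ l ≤ cr p ∧ cs p + cr p ≤ m} := by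
  intro p hp q hq a b ha hb hab
  simp only [mem_ofPred_eq] at *
  have e1 : cs (a • p + b • q) = a * cs p + b * cs q := by simpa using cs_comb a b 0 p q q
  have e2 : cr (a • p + b • q) = a * cr p + b * cr q := by simpa using cr_comb a b 0 p q q
  rw [e1, e2]
  obtain ⟨p1, p2, p3⟩ := hp
  obtain ⟨q1, q2, q3⟩ := hq
  have hb' : b = 1 - a := by linarith
  subst hb'
  refine ⟨?_, ?_, ?_⟩ <;> nlinarith

theorem tri_hull : convexHull ℝ {((0 : ℝ), (0 : ℝ)), ((1 : ℝ), (0 : ℝ)),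
    ((1 / 2 : ℝ), (Real.sqrt 3 / 2 : ℝ))} = {p | 0 ≤ cs p ∧ 0 ≤ cr p ∧ cs p + cr p ≤ 1} := by
  have h3 := sqrt3_sq
  have A1 : cs ((1 / 2 : ℝ), (Real.sqrt 3 / 2 : ℝ)) = 0 := by simp only [cs]; nlinarith
  have A2 : cr ((1 / 2 : ℝ), (Real.sqrt 3 / 2 : ℝ)) = 1 := by simp only [cr]; nlinarith
  have B1 : cs ((1 : ℝ), (0 : ℝ)) = 1 := by simp [cs]
  have B2 : cr ((1 : ℝ), (0 : ℝ)) = 0 := by simp [cr]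
  have C1 : cs ((0 : ℝ), (0 : ℝ)) = 0 := by simp [cs]
  have C2 : cr ((0 : ℝ), (0 : ℝ)) = 0 := by simp [cr]
  apply Subset.antisymm
  · apply convexHull_min _ (convex_tri 0 0 1)
    rintro p (rfl | rfl | rfl)
    · simp only [mem_ofPred_eq, C1, C2]; norm_num
    · simp only [mem_ofPred_eq, B1, B2]; norm_num
    · simp only [mem_ofPred_eq, A1, A2]; norm_num
  · rintro p ⟨h1, h2, h4⟩
    refine mem_hull3 (P := ((0 : ℝ), (0 : ℝ))) (Q := ((1 : ℝ), (0 : ℝ)))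
      (R := ((1 / 2 : ℝ), (Real.sqrt 3 / 2 : ℝ))) (a := 1 - cs p - cr p) (b := cs p) (c := cr p)
      (by simp) (by simp) (by simp) (by linarith) h1 h2 (by ring) ?_
    apply pt_ext
    · rw [cs_comb, A1, B1, C1]; ring
    · rw [cr_comb, A2, B2, C2]; ring

theorem star_range : (Set.range fun k : Fin 3 =>
    ((Real.sqrt 3 * Real.cos (Real.pi / 2 + 2 * k * Real.pi / 3),
      Real.sqrt 3 * Real.sin (Real.pi / 2 + 2 * k * Real.pi / 3)) : ℝ × ℝ)) =
    {((0 : ℝ), Real.sqrt 3), ((-3 / 2 : ℝ), -Real.sqrt 3 / 2), ((3 / 2 : ℝ), -Real.sqrt 3 / 2)} := by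
  have h3 := sqrt3_sq
  have v0 : ((Real.sqrt 3 * Real.cos (Real.pi / 2 + 2 * ((0 : Fin 3) : ℕ) * Real.pi / 3),
      Real.sqrt 3 * Real.sin (Real.pi / 2 + 2 * ((0 : Fin 3) : ℕ) * Real.pi / 3)) : ℝ × ℝ)
      = ((0 : ℝ), Real.sqrt 3) := by simp
  have v1 : ((Real.sqrt 3 * Real.cos (Real.pi / 2 + 2 * ((1 : Fin 3) : ℕ) * Real.pi / 3),
      Real.sqrt 3 * Real.sin (Real.pi / 2 + 2 * ((1 : Fin 3) : ℕ) * Real.pi / 3)) : ℝ × ℝ)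
      = ((-3 / 2 : ℝ), -Real.sqrt 3 / 2) := by
    have e : Real.pi / 2 + 2 * ((1 : Fin 3) : ℕ) * Real.pi / 3 = Real.pi / 6 + Real.pi := by
      simp; ring
    rw [e, Real.cos_add_pi, Real.sin_add_pi, Real.cos_pi_div_six, Real.sin_pi_div_six]
    ext <;> simp <;> nlinarith
  have v2 : ((Real.sqrt 3 * Real.cos (Real.pi / 2 + 2 * ((2 : Fin 3) : ℕ) * Real.pi / 3),
      Real.sqrt 3 * Real.sin (Real.pi / 2 + 2 * ((2 : Fin 3) : ℕ) * Real.pi / 3)) : ℝ × ℝ)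
      = ((3 / 2 : ℝ), -Real.sqrt 3 / 2) := by
    have e : Real.pi / 2 + 2 * ((2 : Fin 3) : ℕ) * Real.pi / 3 = 2 * Real.pi - Real.pi / 6 := by
      simp; ring
    rw [e, Real.cos_two_pi_sub, Real.sin_two_pi_sub, Real.cos_pi_div_six, Real.sin_pi_div_six]
    ext <;> simp <;> nlinarith
  rw [← v0, ← v1, ← v2]
  ext p
  constructor
  · rintro ⟨k, rfl⟩
    fin_cases k <;> simp
  · rintro (rfl | rfl | rfl)
    exacts [⟨0, rfl⟩, ⟨1, rfl⟩, ⟨2, rfl⟩]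

theorem star_hull : starTriangle = {p | -1 ≤ cs p ∧ -1 ≤ cr p ∧ cs p + cr p ≤ 1} := by
  have h3 := sqrt3_sq
  unfold starTriangle
  rw [star_range]
  have A1 : cs ((0 : ℝ), Real.sqrt 3) = -1 := by simp only [cs]; nlinarith
  have A2 : cr ((0 : ℝ), Real.sqrt 3) = 2 := by simp only [cr]; nlinarith
  have B1 : cs ((-3 / 2 : ℝ), -Real.sqrt 3 / 2) = -1 := by simp only [cs]; nlinarith
  have B2 : cr ((-3 / 2 : ℝ), -Real.sqrt 3 / 2) = -1 := by simp only [cr]; nlinarith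
  have C1 : cs ((3 / 2 : ℝ), -Real.sqrt 3 / 2) = 2 := by simp only [cs]; nlinarith
  have C2 : cr ((3 / 2 : ℝ), -Real.sqrt 3 / 2) = -1 := by simp only [cr]; nlinarith
  apply Subset.antisymm
  · apply convexHull_min _ (convex_tri (-1) (-1) 1)
    rintro p (rfl | rfl | rfl)
    · simp only [mem_ofPred_eq, A1, A2]; norm_num
    · simp only [mem_ofPred_eq, B1, B2]; norm_num
    · simp only [mem_ofPred_eq, C1, C2]; norm_num
  · rintro p ⟨h1, h2, h4⟩
    refine mem_hull3 (P := ((0 : ℝ), Real.sqrt 3)) (Q := ((-3 / 2 : ℝ), -Real.sqrt 3 / 2))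
      (R := ((3 / 2 : ℝ), -Real.sqrt 3 / 2)) (a := (cr p + 1) / 3)
      (b := (1 - cs p - cr p) / 3) (c := (cs p + 1) / 3)
      (by simp) (by simp) (by simp) (by linarith) (by linarith) (by linarith) (by ring) ?_
    apply pt_ext
    · rw [cs_comb, A1, B1, C1]; ring
    · rw [cr_comb, A2, B2, C2]; ring

theorem isOpen_tri (k l m : ℝ) : IsOpen {p | k < cs p ∧ l < cr p ∧ cs p + cr p < m} :=
  (isOpen_lt continuous_const continuous_cs).inter
    ((isOpen_lt continuous_const continuous_cr).inter
      (isOpen_lt (continuous_cs.add continuous_cr) continuous_const))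

theorem isClosed_tri (k l m : ℝ) : IsClosed {p | k ≤ cs p ∧ l ≤ cr p ∧ cs p + cr p ≤ m} :=
  (isClosed_le continuous_const continuous_cs).inter
    ((isClosed_le continuous_const continuous_cr).inter
      (isClosed_le (continuous_cs.add continuous_cr) continuous_const))

theorem interior_tri (k l m : ℝ) : interior {p | k ≤ cs p ∧ l ≤ cr p ∧ cs p + cr p ≤ m} =
    {p | k < cs p ∧ l < cr p ∧ cs p + cr p < m} := by
  apply Subset.antisymm
  · intro p hp
    have key : ∀ v : ℝ × ℝ, ∃ t : ℝ, 0 < t ∧ k ≤ cs p + t * cs v ∧ l ≤ cr p + t * cr v ∧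
        cs p + t * cs v + (cr p + t * cr v) ≤ m := by
      intro v
      have hc : Continuous (fun t : ℝ => p + t • v) := by fun_prop
      have h0 : ∀ᶠ t in 𝓝 (0 : ℝ), p + t • v ∈
          {p | k ≤ cs p ∧ l ≤ cr p ∧ cs p + cr p ≤ m} := by
        apply hc.continuousAt.eventually
        simp only [zero_smul, add_zero]
        exact mem_interior_iff_mem_nhds.1 hp
      have h1 : ∀ᶠ t in 𝓝[>] (0 : ℝ), p + t • v ∈
          {p | k ≤ cs p ∧ l ≤ cr p ∧ cs p + cr p ≤ m} := h0.filter_mono nhdsWithin_le_nhds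
      obtain ⟨t, ht, ht0⟩ := (h1.and self_mem_nhdsWithin).exists
      refine ⟨t, ht0, ?_⟩
      have e1 : cs (p + t • v) = cs p + t * cs v := by simpa using cs_comb 1 t 0 p v v
      have e2 : cr (p + t • v) = cr p + t * cr v := by simpa using cr_comb 1 t 0 p v v
      rw [mem_ofPred_eq, e1, e2] at ht
      exact ht
    have A1 : cs ((1 : ℝ), (0 : ℝ)) = 1 := by simp [cs]
    have A2 : cr ((1 : ℝ), (0 : ℝ)) = 0 := by simp [cr]
    have B1 : cs ((-1 : ℝ), (0 : ℝ)) = -1 := by simp [cs]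
    have B2 : cr ((-1 : ℝ), (0 : ℝ)) = 0 := by simp [cr]
    have C1 : cs ((-1 / 2 : ℝ), (-Real.sqrt 3 / 2 : ℝ)) = 0 := by
      simp only [cs]; nlinarith [sqrt3_sq]
    have C2 : cr ((-1 / 2 : ℝ), (-Real.sqrt 3 / 2 : ℝ)) = -1 := by
      simp only [cr]; nlinarith [sqrt3_sq]
    obtain ⟨t, ht, -, -, h1⟩ := key ((1 : ℝ), (0 : ℝ))
    obtain ⟨t', ht', h2, -, -⟩ := key ((-1 : ℝ), (0 : ℝ))
    obtain ⟨t'', ht'', -, h3, -⟩ := key ((-1 / 2 : ℝ), (-Real.sqrt 3 / 2 : ℝ))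
    rw [A1, A2] at h1
    rw [B1] at h2
    rw [C2] at h3
    refine ⟨by linarith, by linarith, by linarith⟩
  · apply interior_maximal _ (isOpen_tri k l m)
    rintro p ⟨h1, h2, h3⟩
    exact ⟨h1.le, h2.le, h3.le⟩

/-- The closed triangle. -/
def triK : Set (ℝ × ℝ) := {p | 0 ≤ cs p ∧ 0 ≤ cr p ∧ cs p + cr p ≤ 1}

theorem equi_eq : equilateralTriangle = {p | 0 < cs p ∧ 0 < cr p ∧ cs p + cr p < 1} := by
  unfold equilateralTriangle
  rw [tri_hull, interior_tri]

theorem isOpen_equi : IsOpen equilateralTriangle := isOpen_interior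

theorem equi_sub_K : equilateralTriangle ⊆ triK := by
  rw [equi_eq]
  rintro p ⟨h1, h2, h3⟩
  exact ⟨h1.le, h2.le, h3.le⟩

theorem closure_equi : closure equilateralTriangle = triK := by
  have h : (interior triK).Nonempty := by
    rw [triK, interior_tri]
    refine ⟨((1 / 2 : ℝ), (Real.sqrt 3 / 4 : ℝ)), ?_⟩
    have := sqrt3_sq
    simp only [mem_ofPred_eq, cs, cr]
    refine ⟨by nlinarith, by nlinarith, by nlinarith⟩
  have := (convex_tri 0 0 1).closure_interior_eq_closure_of_nonempty_interior h
  rw [(isClosed_tri 0 0 1).closure_eq] at this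
  rw [equilateralTriangle, tri_hull, this, triK]

theorem frontier_equi : frontier equilateralTriangle = triK \ equilateralTriangle := by
  rw [frontier, closure_equi, isOpen_equi.interior_eq]

theorem triK_bound {p : ℝ × ℝ} (hp : p ∈ triK) : 0 ≤ p.1 ∧ p.1 ≤ 1 ∧ 0 ≤ p.2 ∧ p.2 ≤ 1 := by
  obtain ⟨h1, h2, h3⟩ := hp
  simp only [cs, cr] at h1 h2 h3
  have hs := sqrt3_sq
  have h0 : (0 : ℝ) < Real.sqrt 3 := by positivity
  have hy : 0 ≤ p.2 := by
    by_contra h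
    have := mul_neg_of_pos_of_neg h0 (not_le.1 h)
    linarith
  have hm := mul_nonneg h0.le hy
  have hx : 0 ≤ p.1 := by linarith
  have h17 : 1.5 < Real.sqrt 3 := by
    apply Real.lt_sqrt_of_sq_lt; norm_num
  refine ⟨hx, by linarith, hy, ?_⟩
  nlinarith

theorem isCompact_triK : IsCompact triK := by
  apply (isCompact_Icc (a := ((0 : ℝ), (0 : ℝ))) (b := ((1 : ℝ), (1 : ℝ)))).of_isClosed_subset
    (isClosed_tri 0 0 1)
  intro p hp
  obtain ⟨a, b, c, d⟩ := triK_bound hp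
  exact ⟨⟨a, c⟩, ⟨b, d⟩⟩

theorem equi_sub_hex : equilateralTriangle ⊆ hexagram := by
  rw [equi_eq, hexagram, star_hull, interior_tri]
  rintro p ⟨h1, h2, h3⟩
  left
  refine ⟨by linarith, by linarith, by linarith⟩

theorem frontier_star {p : ℝ × ℝ} (hp : p ∈ frontier (interior starTriangle)) :
    cs p = -1 ∨ cr p = -1 ∨ cs p + cr p = 1 := by
  rw [frontier, interior_interior] at hp
  have h1 : p ∈ starTriangle := by
    rw [star_hull] at hp ⊢
    exact (isClosed_tri _ _ _).closure_subset_iff.2 interior_subset hp.1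
  have h2 := hp.2
  rw [star_hull] at h1 h2
  rw [interior_tri] at h2
  obtain ⟨a, b, c⟩ := h1
  by_contra! h
  exact h2 ⟨lt_of_le_of_ne a h.1.symm, lt_of_le_of_ne b h.2.1.symm, lt_of_le_of_ne c h.2.2⟩

theorem frontier_hex {p : ℝ × ℝ} (hp : p ∈ frontier hexagram) :
    (cs p = -1 ∨ cr p = -1 ∨ cs p + cr p = 1) ∨ (cs p = 1 ∨ cr p = 1 ∨ cs p + cr p = -1) := by
  have hp' := frontier_union_subset _ _ hp
  rcases hp' with h | h
  · left; exact frontier_star h.1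
  · right
    have e : interior ((fun p : ℝ × ℝ => -p) '' starTriangle) =
        (Homeomorph.neg (ℝ × ℝ)) '' (interior starTriangle) := by
      rw [Homeomorph.image_interior]; rfl
    have h2 := h.2
    rw [e, ← Homeomorph.image_frontier] at h2
    obtain ⟨q, hq, rfl⟩ := h2
    have e1 : cs (-q) = - cs q := by simp [cs]; ring
    have e2 : cr (-q) = - cr q := by simp [cr]
    simp only [Homeomorph.coe_neg, e1, e2]
    rcases frontier_star hq with h | h | h
    · left; linarith
    · right; left; linarith
    · right; right; linarith

end Geometry

section Cutoff
open Set Filter Topology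

/-- One-dimensional smooth cutoff. -/
noncomputable def hcut (s : ℝ) : ℝ := Real.smoothTransition (s - 1)

theorem hcut_contDiff : ContDiff ℝ 2 hcut :=
  (Real.smoothTransition.contDiff (n := 2)).comp (contDiff_id.sub contDiff_const)

theorem hcut_abs_le (s : ℝ) : |hcut s| ≤ 1 := by
  rw [abs_le]
  have h1 := Real.smoothTransition.nonneg (s - 1)
  have h2 := Real.smoothTransition.le_one (s - 1)
  unfold hcut
  constructor <;> linarith

theorem hcut_zero {s : ℝ} (h : s ≤ 1) : hcut s = 0 :=
  Real.smoothTransition.zero_of_nonpos (by linarith)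

theorem hcut_one {s : ℝ} (h : 2 ≤ s) : hcut s = 1 :=
  Real.smoothTransition.one_of_one_le (by linarith)

theorem hcut_deriv_out {s : ℝ} (h : s < 1 ∨ 2 < s) : deriv hcut s = 0 := by
  rcases h with h | h
  · have : hcut =ᶠ[𝓝 s] fun _ => 0 := by
      filter_upwards [Iio_mem_nhds h] with x hx
      exact hcut_zero (le_of_lt hx)
    rw [this.deriv_eq]; simp
  · have : hcut =ᶠ[𝓝 s] fun _ => 1 := by
      filter_upwards [Ioi_mem_nhds h] with x hx
      exact hcut_one (le_of_lt hx)
    rw [this.deriv_eq]; simp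

theorem hcut_deriv2_out {s : ℝ} (h : s < 1 ∨ 2 < s) : deriv (deriv hcut) s = 0 := by
  have : deriv hcut =ᶠ[𝓝 s] fun _ => 0 := by
    rcases h with h | h
    · filter_upwards [Iio_mem_nhds h] with x hx
      exact hcut_deriv_out (Or.inl hx)
    · filter_upwards [Ioi_mem_nhds h] with x hx
      exact hcut_deriv_out (Or.inr hx)
  rw [this.deriv_eq]; simp

theorem contDiff_deriv_one {f : ℝ → ℝ} (hf : ContDiff ℝ 2 f) : ContDiff ℝ 1 (deriv f) := by
  have h : ContDiff ℝ (1 + 1) f := by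
    rw [one_add_one_eq_two]; exact hf
  exact (contDiff_succ_iff_deriv.1 h).2.2

theorem hcut_deriv_contDiff : ContDiff ℝ 1 (deriv hcut) := contDiff_deriv_one hcut_contDiff

theorem hcut_bounds : ∃ C : ℝ, 1 ≤ C ∧ (∀ s, |deriv hcut s| ≤ C) ∧
    ∀ s, |deriv (deriv hcut) s| ≤ C := by
  have c1 : Continuous (deriv hcut) := hcut_deriv_contDiff.continuous
  have c2 : Continuous (deriv (deriv hcut)) := hcut_deriv_contDiff.continuous_deriv (by norm_num)
  obtain ⟨C1, h1⟩ := (isCompact_Icc (a := (1 : ℝ)) (b := 2)).exists_bound_of_continuousOn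
    c1.continuousOn
  obtain ⟨C2, h2⟩ := (isCompact_Icc (a := (1 : ℝ)) (b := 2)).exists_bound_of_continuousOn
    c2.continuousOn
  refine ⟨max 1 (max C1 C2), le_max_left _ _, fun s => ?_, fun s => ?_⟩
  · by_cases hs : s ∈ Icc (1 : ℝ) 2
    · exact (h1 s hs).trans ((le_max_left _ _).trans (le_max_right _ _))
    · rw [hcut_deriv_out]
      · simp
      · by_contra! h
        exact hs h
  · by_cases hs : s ∈ Icc (1 : ℝ) 2
    · exact (h2 s hs).trans ((le_max_right _ _).trans (le_max_right _ _))
    · rw [hcut_deriv2_out]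
      · simp
      · by_contra! h
        exact hs h

/-- Product of three one-dimensional cutoffs. -/
noncomputable def xcut (a₁ c₁ a₂ c₂ a₃ c₃ x : ℝ) : ℝ :=
  hcut (a₁ * x + c₁) * hcut (a₂ * x + c₂) * hcut (a₃ * x + c₃)

theorem hasDerivAt_affine (f : ℝ → ℝ) (hf : Differentiable ℝ f) (a c x : ℝ) :
    HasDerivAt (fun x => f (a * x + c)) (deriv f (a * x + c) * a) x := by
  have h1 : HasDerivAt (fun x => a * x + c) a x := by
    simpa using ((hasDerivAt_id x).const_mul a).add_const c
  exact (hf (a * x + c)).hasDerivAt.comp x h1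

theorem xcut_bounds : ∃ C : ℝ, 0 ≤ C ∧ ∀ a₁ c₁ a₂ c₂ a₃ c₃ A : ℝ, |a₁| ≤ A → |a₂| ≤ A → |a₃| ≤ A →
    ∀ x, |deriv (xcut a₁ c₁ a₂ c₂ a₃ c₃) x| ≤ C * A ∧
      |deriv (deriv (xcut a₁ c₁ a₂ c₂ a₃ c₃)) x| ≤ C * A ^ 2 := by
  obtain ⟨C, hC, b1, b2⟩ := hcut_bounds
  refine ⟨9 * C ^ 2, by positivity, ?_⟩
  intro a₁ c₁ a₂ c₂ a₃ c₃ A h1 h2 h3 x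
  have hA : 0 ≤ A := (abs_nonneg _).trans h1
  have d1 : Differentiable ℝ hcut := hcut_contDiff.differentiable (by norm_num)
  have d2 : Differentiable ℝ (deriv hcut) := hcut_deriv_contDiff.differentiable (by norm_num)
  have e1 : deriv (xcut a₁ c₁ a₂ c₂ a₃ c₃) = fun x =>
      (deriv hcut (a₁ * x + c₁) * a₁ * hcut (a₂ * x + c₂) +
        hcut (a₁ * x + c₁) * (deriv hcut (a₂ * x + c₂) * a₂)) * hcut (a₃ * x + c₃) +
      hcut (a₁ * x + c₁) * hcut (a₂ * x + c₂) * (deriv hcut (a₃ * x + c₃) * a₃) := by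
    funext x
    exact (((hasDerivAt_affine hcut d1 a₁ c₁ x).mul (hasDerivAt_affine hcut d1 a₂ c₂ x)).mul
      (hasDerivAt_affine hcut d1 a₃ c₃ x)).deriv
  have e2 : deriv (deriv (xcut a₁ c₁ a₂ c₂ a₃ c₃)) x =
      ((deriv (deriv hcut) (a₁ * x + c₁) * a₁ * a₁ * hcut (a₂ * x + c₂) +
        deriv hcut (a₁ * x + c₁) * a₁ * (deriv hcut (a₂ * x + c₂) * a₂)) +
        (deriv hcut (a₁ * x + c₁) * a₁ * (deriv hcut (a₂ * x + c₂) * a₂) +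
        hcut (a₁ * x + c₁) * (deriv (deriv hcut) (a₂ * x + c₂) * a₂ * a₂))) * hcut (a₃ * x + c₃) +
      (deriv hcut (a₁ * x + c₁) * a₁ * hcut (a₂ * x + c₂) +
        hcut (a₁ * x + c₁) * (deriv hcut (a₂ * x + c₂) * a₂)) *
          (deriv hcut (a₃ * x + c₃) * a₃) +
      ((deriv hcut (a₁ * x + c₁) * a₁ * hcut (a₂ * x + c₂) +
        hcut (a₁ * x + c₁) * (deriv hcut (a₂ * x + c₂) * a₂)) * (deriv hcut (a₃ * x + c₃) * a₃) +
      hcut (a₁ * x + c₁) * hcut (a₂ * x + c₂) *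
        (deriv (deriv hcut) (a₃ * x + c₃) * a₃ * a₃)) := by
    rw [e1]
    have q1 := hasDerivAt_affine hcut d1 a₁ c₁ x
    have q2 := hasDerivAt_affine hcut d1 a₂ c₂ x
    have q3 := hasDerivAt_affine hcut d1 a₃ c₃ x
    have r1 := (hasDerivAt_affine (deriv hcut) d2 a₁ c₁ x).mul_const a₁
    have r2 := (hasDerivAt_affine (deriv hcut) d2 a₂ c₂ x).mul_const a₂
    have r3 := (hasDerivAt_affine (deriv hcut) d2 a₃ c₃ x).mul_const a₃
    exact ((((r1.mul q2).add (q1.mul r2)).mul q3).add ((q1.mul q2).mul r3)).deriv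
  have H : ∀ p q r : ℝ, ∀ P Q R : ℝ, |p| ≤ P → |q| ≤ Q → |r| ≤ R → |p * q * r| ≤ P * Q * R := by
    intro p q r P Q R hp hq hr
    rw [abs_mul, abs_mul]
    have hP := (abs_nonneg p).trans hp
    have hQ := (abs_nonneg q).trans hq
    gcongr
  have k0 : ∀ s, |hcut s| ≤ 1 := hcut_abs_le
  have k1 : ∀ s a, |a| ≤ A → |deriv hcut s * a| ≤ C * A := by
    intro s a ha
    rw [abs_mul]
    have := b1 s
    gcongr
  have k2 : ∀ s a, |a| ≤ A → |deriv (deriv hcut) s * a * a| ≤ C * A * A := fun s a ha =>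
    H _ _ _ _ _ _ (b2 s) ha ha
  constructor
  · rw [e1]
    have t1 := H _ _ _ _ _ _ (k1 (a₁ * x + c₁) a₁ h1) (k0 (a₂ * x + c₂)) (k0 (a₃ * x + c₃))
    have t2 := H _ _ _ _ _ _ (k0 (a₁ * x + c₁)) (k1 (a₂ * x + c₂) a₂ h2) (k0 (a₃ * x + c₃))
    have t3 := H _ _ _ _ _ _ (k0 (a₁ * x + c₁)) (k0 (a₂ * x + c₂)) (k1 (a₃ * x + c₃) a₃ h3)
    have hCC : C * A ≤ C ^ 2 * A := by
      have : C ≤ C ^ 2 := by nlinarith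
      gcongr
    have hCA : 0 ≤ C * A := by positivity
    rw [abs_le] at *
    constructor <;> nlinarith
  · rw [e2]
    have s1 := H _ _ _ _ _ _ (k2 (a₁ * x + c₁) a₁ h1) (k0 (a₂ * x + c₂)) (k0 (a₃ * x + c₃))
    have s2 := H _ _ _ _ _ _ (k0 (a₁ * x + c₁)) (k2 (a₂ * x + c₂) a₂ h2) (k0 (a₃ * x + c₃))
    have s3 := H _ _ _ _ _ _ (k0 (a₁ * x + c₁)) (k0 (a₂ * x + c₂)) (k2 (a₃ * x + c₃) a₃ h3)
    have t1 := H _ _ _ _ _ _ (k0 (a₁ * x + c₁)) (k1 (a₂ * x + c₂) a₂ h2) (k1 (a₃ * x + c₃) a₃ h3)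
    have t2 := H _ _ _ _ _ _ (k1 (a₁ * x + c₁) a₁ h1) (k0 (a₂ * x + c₂)) (k1 (a₃ * x + c₃) a₃ h3)
    have t3 := H _ _ _ _ _ _ (k1 (a₁ * x + c₁) a₁ h1) (k1 (a₂ * x + c₂) a₂ h2) (k0 (a₃ * x + c₃))
    have hCC : C * A ^ 2 ≤ C ^ 2 * A ^ 2 := by
      have : C ≤ C ^ 2 := by nlinarith
      gcongr
    generalize hcut (a₁ * x + c₁) = f1 at *
    generalize hcut (a₂ * x + c₂) = f2 at *
    generalize hcut (a₃ * x + c₃) = f3 at *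
    generalize deriv hcut (a₁ * x + c₁) = g1 at *
    generalize deriv hcut (a₂ * x + c₂) = g2 at *
    generalize deriv hcut (a₃ * x + c₃) = g3 at *
    generalize deriv (deriv hcut) (a₁ * x + c₁) = j1 at *
    generalize deriv (deriv hcut) (a₂ * x + c₂) = j2 at *
    generalize deriv (deriv hcut) (a₃ * x + c₃) = j3 at *
    rw [abs_le] at s1 s2 s3 t1 t2 t3 ⊢
    constructor <;> linarith

/-- The cutoff function in the triangle. -/
noncomputable def chi (ε : ℝ) (p : ℝ × ℝ) : ℝ :=
  hcut (ε⁻¹ * cs p) * hcut (ε⁻¹ * cr p) * hcut (ε⁻¹ * (1 - cs p - cr p))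

theorem chi_contDiff (ε : ℝ) : ContDiff ℝ 2 (chi ε) := by
  have h1 : ContDiff ℝ 2 cs := by unfold cs; fun_prop
  have h2 : ContDiff ℝ 2 cr := by unfold cr; fun_prop
  unfold chi
  exact ((hcut_contDiff.comp (contDiff_const.mul h1)).mul
    (hcut_contDiff.comp (contDiff_const.mul h2))).mul
    (hcut_contDiff.comp (contDiff_const.mul ((contDiff_const.sub h1).sub h2)))

theorem chi_abs_le (ε : ℝ) (p : ℝ × ℝ) : |chi ε p| ≤ 1 := by
  unfold chi
  rw [abs_mul, abs_mul]
  have h1 := hcut_abs_le (ε⁻¹ * cs p)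
  have h2 := hcut_abs_le (ε⁻¹ * cr p)
  have h3 := hcut_abs_le (ε⁻¹ * (1 - cs p - cr p))
  have := mul_le_mul (mul_le_mul h1 h2 (abs_nonneg _) zero_le_one) h3 (abs_nonneg _) (by norm_num)
  simpa using this

theorem chi_slice_x (ε y : ℝ) : (fun x => chi ε (x, y)) =
    xcut ε⁻¹ (-(ε⁻¹ * (Real.sqrt 3 / 3 * y))) 0 (ε⁻¹ * (2 * Real.sqrt 3 / 3 * y))
      (-ε⁻¹) (ε⁻¹ * (1 - Real.sqrt 3 / 3 * y)) := by
  funext x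
  simp only [chi, xcut, cs, cr]
  congr 2
  · congr 2; ring1
  · congr 1; ring1
  · ring1

theorem chi_slice_y (ε x : ℝ) : (fun y => chi ε (x, y)) =
    xcut (-ε⁻¹ * (Real.sqrt 3 / 3)) (ε⁻¹ * x) (ε⁻¹ * (2 * Real.sqrt 3 / 3)) 0
      (-ε⁻¹ * (Real.sqrt 3 / 3)) (ε⁻¹ * (1 - x)) := by
  funext y
  simp only [chi, xcut, cs, cr]
  congr 2
  · congr 2; ring1
  · congr 1; ring1
  · ring1

theorem chi_bounds : ∃ C : ℝ, 0 ≤ C ∧ ∀ ε : ℝ, 0 < ε → ∀ p : ℝ × ℝ,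
    |deriv (fun x => chi ε (x, p.2)) p.1| ≤ C * ε⁻¹ ∧
    |deriv (fun y => chi ε (p.1, y)) p.2| ≤ C * ε⁻¹ ∧
    |lap2 (chi ε) p| ≤ C * (ε⁻¹) ^ 2 := by
  obtain ⟨C, hC, H⟩ := xcut_bounds
  refine ⟨8 * C, by positivity, fun ε hε p => ?_⟩
  have hi : 0 < ε⁻¹ := by positivity
  have h3 : Real.sqrt 3 ≤ 2 := by
    rw [Real.sqrt_le_left (by norm_num)]; norm_num
  have h3' : 0 ≤ Real.sqrt 3 := Real.sqrt_nonneg 3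
  have m1 : Real.sqrt 3 / 3 * ε⁻¹ ≤ 2 * ε⁻¹ := by gcongr; linarith
  have m2 : 2 * Real.sqrt 3 / 3 * ε⁻¹ ≤ 2 * ε⁻¹ := by gcongr; linarith
  have n1 : 0 ≤ Real.sqrt 3 / 3 * ε⁻¹ := by positivity
  have n2 : 0 ≤ 2 * Real.sqrt 3 / 3 * ε⁻¹ := by positivity
  have X := H ε⁻¹ (-(ε⁻¹ * (Real.sqrt 3 / 3 * p.2))) 0 (ε⁻¹ * (2 * Real.sqrt 3 / 3 * p.2))
      (-ε⁻¹) (ε⁻¹ * (1 - Real.sqrt 3 / 3 * p.2)) (2 * ε⁻¹)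
      (by rw [abs_le]; constructor <;> linarith)
      (by rw [abs_le]; constructor <;> linarith)
      (by rw [abs_le]; constructor <;> linarith) p.1
  have Y := H (-ε⁻¹ * (Real.sqrt 3 / 3)) (ε⁻¹ * p.1) (ε⁻¹ * (2 * Real.sqrt 3 / 3)) 0
      (-ε⁻¹ * (Real.sqrt 3 / 3)) (ε⁻¹ * (1 - p.1)) (2 * ε⁻¹)
      (by rw [abs_le]; constructor <;> linarith)
      (by rw [abs_le]; constructor <;> linarith)
      (by rw [abs_le]; constructor <;> linarith) p.2
  rw [← chi_slice_x] at X
  rw [← chi_slice_y] at Y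
  have hCi : 0 ≤ C * ε⁻¹ := by positivity
  refine ⟨by linarith [X.1], by linarith [Y.1], ?_⟩
  unfold lap2
  refine (abs_add_le _ _).trans ?_
  linarith [X.2, Y.2]

theorem chi_one {ε : ℝ} (hε : 0 < ε) {p : ℝ × ℝ} (h1 : 2 * ε ≤ cs p) (h2 : 2 * ε ≤ cr p)
    (h3 : 2 * ε ≤ 1 - cs p - cr p) : chi ε p = 1 := by
  have : ∀ s, 2 * ε ≤ s → hcut (ε⁻¹ * s) = 1 := by
    intro s hs
    apply hcut_one
    rw [inv_mul_eq_div, le_div_iff₀ hε]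
    exact hs
  simp [chi, this _ h1, this _ h2, this _ h3]

theorem chi_support {ε : ℝ} (hε : 0 < ε) {p : ℝ × ℝ} (h : chi ε p ≠ 0) :
    ε ≤ cs p ∧ ε ≤ cr p ∧ cs p + cr p ≤ 1 - ε := by
  have : ∀ s, hcut (ε⁻¹ * s) ≠ 0 → ε ≤ s := by
    intro s hs
    by_contra! hh
    apply hs
    apply hcut_zero
    rw [inv_mul_eq_div, div_le_iff₀ hε]
    linarith
  simp only [chi, ne_eq, mul_eq_zero, not_or] at h
  refine ⟨this _ h.1.1, this _ h.1.2, by linarith [this _ h.2]⟩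

theorem deriv2_mul {f g : ℝ → ℝ} (hf : ContDiff ℝ 2 f) (hg : ContDiff ℝ 2 g) (x : ℝ) :
    deriv (deriv fun x => f x * g x) x =
      deriv (deriv f) x * g x + 2 * (deriv f x * deriv g x) + f x * deriv (deriv g) x := by
  have f1 : Differentiable ℝ f := hf.differentiable (by norm_num)
  have g1 : Differentiable ℝ g := hg.differentiable (by norm_num)
  have f2 : Differentiable ℝ (deriv f) :=
    (contDiff_deriv_one hf).differentiable (by norm_num)
  have g2 : Differentiable ℝ (deriv g) :=
    (contDiff_deriv_one hg).differentiable (by norm_num)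
  have e : deriv (fun x => f x * g x) = fun x => deriv f x * g x + f x * deriv g x := by
    funext x
    exact ((f1 x).hasDerivAt.mul (g1 x).hasDerivAt).deriv
  rw [e]
  have := (((f2 x).hasDerivAt.mul (g1 x).hasDerivAt).add
    ((f1 x).hasDerivAt.mul (g2 x).hasDerivAt)).deriv
  refine Eq.trans this ?_
  ring

theorem slice_contDiff_x {f : ℝ × ℝ → ℝ} (hf : ContDiff ℝ 2 f) (y : ℝ) :
    ContDiff ℝ 2 (fun x => f (x, y)) := hf.comp (contDiff_id.prodMk contDiff_const)

theorem slice_contDiff_y {f : ℝ × ℝ → ℝ} (hf : ContDiff ℝ 2 f) (x : ℝ) :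
    ContDiff ℝ 2 (fun y => f (x, y)) := hf.comp (contDiff_const.prodMk contDiff_id)

theorem lap2_mul {f g : ℝ × ℝ → ℝ} (hf : ContDiff ℝ 2 f) (hg : ContDiff ℝ 2 g) (p : ℝ × ℝ) :
    lap2 (fun q => f q * g q) p = f p * lap2 g p + (lap2 f p * g p +
      2 * (deriv (fun x => f (x, p.2)) p.1 * deriv (fun x => g (x, p.2)) p.1 +
        deriv (fun y => f (p.1, y)) p.2 * deriv (fun y => g (p.1, y)) p.2)) := by
  have e1 := deriv2_mul (slice_contDiff_x hf p.2) (slice_contDiff_x hg p.2) p.1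
  have e2 := deriv2_mul (slice_contDiff_y hf p.1) (slice_contDiff_y hg p.1) p.2
  unfold lap2
  rw [e1, e2]
  simp only [Prod.mk.eta]
  ring

end Cutoff

section Orth
open Set Filter Topology MeasureTheory

/-- The part of the closed triangle close to its boundary. -/
def strip (ε : ℝ) : Set (ℝ × ℝ) :=
  triK ∩ {p | cs p ≤ 2 * ε ∨ cr p ≤ 2 * ε ∨ 1 - cs p - cr p ≤ 2 * ε}

theorem volume_band (f : ℝ → ℝ) (hf : Continuous f) {w : ℝ} (hw : 0 ≤ w) :
    volume (regionBetween f (fun x => f x + w) (Icc (0 : ℝ) 1)) = ENNReal.ofReal w := by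
  have hg : Continuous (fun x => f x + w) := hf.add continuous_const
  rw [Measure.volume_eq_prod, volume_regionBetween_eq_integral
    (hf.continuousOn.integrableOn_compact isCompact_Icc)
    (hg.continuousOn.integrableOn_compact isCompact_Icc) measurableSet_Icc
    (fun x _ => by linarith)]
  simp

theorem strip_volume {ε : ℝ} (hε : 0 < ε) :
    volume (strip ε) ≤ ENNReal.ofReal (30 * ε) := by
  have h3 := sqrt3_sq
  have h0 : (0 : ℝ) < Real.sqrt 3 := by positivity
  have h2 : Real.sqrt 3 < 2 := by
    rw [Real.sqrt_lt' (by norm_num)]; norm_num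
  have hsub : strip ε ⊆
      (regionBetween (fun x => Real.sqrt 3 * (x - 3 * ε)) (fun x => Real.sqrt 3 * (x - 3 * ε) + 10 * ε)
        (Icc (0 : ℝ) 1) ∪
      regionBetween (fun _ => -ε) (fun _ => -ε + 10 * ε) (Icc (0 : ℝ) 1)) ∪
      regionBetween (fun x => Real.sqrt 3 * (1 - x - 3 * ε))
        (fun x => Real.sqrt 3 * (1 - x - 3 * ε) + 10 * ε) (Icc (0 : ℝ) 1) := by
    rintro p ⟨hp, hd⟩
    obtain ⟨b1, b2, b3, b4⟩ := triK_bound hp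
    obtain ⟨k1, k2, k3⟩ := hp
    simp only [cs, cr] at k1 k2 k3 hd
    have m : Real.sqrt 3 * ε < 2 * ε := by gcongr
    have mp : 0 < Real.sqrt 3 * ε := by positivity
    have y3 : Real.sqrt 3 * (Real.sqrt 3 * p.2) = 3 * p.2 := by rw [← mul_assoc, h3]
    rcases hd with h | h | h
    · left; left
      have := mul_le_mul_of_nonneg_left h h0.le
      have := mul_le_mul_of_nonneg_left k1 h0.le
      refine ⟨⟨b1, b2⟩, ?_, ?_⟩ <;> simp only <;> nlinarith
    · left; right
      have := mul_le_mul_of_nonneg_left h h0.le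
      refine ⟨⟨b1, b2⟩, ?_, ?_⟩ <;> simp only <;> nlinarith
    · right
      have := mul_le_mul_of_nonneg_left h h0.le
      have := mul_le_mul_of_nonneg_left k3 h0.le
      refine ⟨⟨b1, b2⟩, ?_, ?_⟩ <;> simp only <;> nlinarith
  refine (measure_mono hsub).trans ((measure_union_le _ _).trans ?_)
  have hw : 0 ≤ 10 * ε := by positivity
  have v1 := volume_band (fun x => Real.sqrt 3 * (x - 3 * ε)) (by fun_prop) hw
  have v2 := volume_band (fun _ => -ε) (by fun_prop) hw
  have v3 := volume_band (fun x => Real.sqrt 3 * (1 - x - 3 * ε)) (by fun_prop) hw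
  refine (add_le_add (measure_union_le _ _) le_rfl).trans ?_
  rw [v1, v2, v3, ← ENNReal.ofReal_add hw hw, ← ENNReal.ofReal_add (by positivity) hw]
  apply ENNReal.ofReal_le_ofReal
  linarith

theorem strip_near {ε : ℝ} {p : ℝ × ℝ} (hp : p ∈ strip ε) :
    ∃ q ∈ triK \ equilateralTriangle, ‖p - q‖ ≤ 2 * ε := by
  have h3 := sqrt3_sq
  have h0 : (0 : ℝ) < Real.sqrt 3 := by positivity
  have h2 : Real.sqrt 3 < 2 := by
    rw [Real.sqrt_lt' (by norm_num)]; norm_num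
  obtain ⟨⟨k1, k2, k3⟩, hd⟩ := hp
  have A1 : cs ((1 : ℝ), (0 : ℝ)) = 1 := by simp [cs]
  have A2 : cr ((1 : ℝ), (0 : ℝ)) = 0 := by simp [cr]
  have C1 : cs ((1 / 2 : ℝ), (Real.sqrt 3 / 2 : ℝ)) = 0 := by simp only [cs]; nlinarith
  have C2 : cr ((1 / 2 : ℝ), (Real.sqrt 3 / 2 : ℝ)) = 1 := by simp only [cr]; nlinarith
  have E1 : ∀ (t : ℝ) (v : ℝ × ℝ), cs (p - t • v) = cs p - t * cs v := by
    intro t v; simp [cs]; ring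
  have E2 : ∀ (t : ℝ) (v : ℝ × ℝ), cr (p - t • v) = cr p - t * cr v := by
    intro t v; simp [cr]; ring
  have nA : ‖((1 : ℝ), (0 : ℝ))‖ ≤ 1 := by simp [Prod.norm_def]
  have nC : ‖((1 / 2 : ℝ), (Real.sqrt 3 / 2 : ℝ))‖ ≤ 1 := by
    rw [Prod.norm_def]
    apply max_le
    · rw [Real.norm_eq_abs, abs_le]; constructor <;> norm_num
    · rw [Real.norm_eq_abs, abs_le]; constructor <;> linarith
  have N : ∀ (t : ℝ) (v : ℝ × ℝ), |t| ≤ 2 * ε → ‖v‖ ≤ 1 → ‖p - (p - t • v)‖ ≤ 2 * ε := by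
    intro t v ht hv
    rw [sub_sub_cancel, norm_smul, Real.norm_eq_abs]
    have := mul_le_mul ht hv (norm_nonneg _) ((abs_nonneg _).trans ht)
    linarith
  rw [equi_eq]
  rcases hd with h | h | h
  · refine ⟨p - cs p • ((1 : ℝ), (0 : ℝ)), ⟨?_, ?_⟩, N _ _ ?_ nA⟩
    · simp only [triK, mem_ofPred_eq, E1, E2, A1, A2]
      refine ⟨by linarith, by linarith, by linarith⟩
    · simp only [mem_ofPred_eq, E1, E2, A1, A2]
      rintro ⟨a, b, c⟩; linarith
    · rwa [abs_of_nonneg k1]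
  · refine ⟨p - cr p • ((1 / 2 : ℝ), (Real.sqrt 3 / 2 : ℝ)), ⟨?_, ?_⟩, N _ _ ?_ nC⟩
    · simp only [triK, mem_ofPred_eq, E1, E2, C1, C2]
      refine ⟨by linarith, by linarith, by linarith⟩
    · simp only [mem_ofPred_eq, E1, E2, C1, C2]
      rintro ⟨a, b, c⟩; linarith
    · rwa [abs_of_nonneg k2]
  · refine ⟨p - (-(1 - cs p - cr p)) • ((1 : ℝ), (0 : ℝ)), ⟨?_, ?_⟩, N _ _ ?_ nA⟩
    · simp only [triK, mem_ofPred_eq, E1, E2, A1, A2]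
      refine ⟨by linarith, by linarith, by linarith⟩
    · simp only [mem_ofPred_eq, E1, E2, A1, A2]
      rintro ⟨a, b, c⟩; linarith
    · rwa [abs_neg, abs_of_nonneg (by linarith)]

/-- The remainder term in the Laplacian of the truncated function. -/
noncomputable def remd (ε : ℝ) (φ : ℝ × ℝ → ℝ) (p : ℝ × ℝ) : ℝ :=
  lap2 (chi ε) p * φ p +
      2 * (deriv (fun x => chi ε (x, p.2)) p.1 * deriv (fun x => φ (x, p.2)) p.1 +
        deriv (fun y => chi ε (p.1, y)) p.2 * deriv (fun y => φ (p.1, y)) p.2)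

theorem remd_zero {ε : ℝ} (hε : 0 < ε) (φ : ℝ × ℝ → ℝ) {p : ℝ × ℝ} (hp : p ∈ triK)
    (hp' : p ∉ strip ε) : remd ε φ p = 0 := by
  have hp2 : 2 * ε < cs p ∧ 2 * ε < cr p ∧ cs p + cr p < 1 - 2 * ε := by
    have : ¬ (cs p ≤ 2 * ε ∨ cr p ≤ 2 * ε ∨ 1 - cs p - cr p ≤ 2 * ε) := fun h => hp' ⟨hp, h⟩
    push Not at this
    exact ⟨this.1, this.2.1, by linarith [this.2.2]⟩
  have ho := (isOpen_tri (2 * ε) (2 * ε) (1 - 2 * ε)).mem_nhds hp2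
  have hone : ∀ q ∈ {p | 2 * ε < cs p ∧ 2 * ε < cr p ∧ cs p + cr p < 1 - 2 * ε}, chi ε q = 1 := by
    rintro q ⟨h1, h2, h3⟩
    exact chi_one hε h1.le h2.le (by linarith)
  have c1 : Continuous (fun x : ℝ => ((x, p.2) : ℝ × ℝ)) := by fun_prop
  have c2 : Continuous (fun y : ℝ => ((p.1, y) : ℝ × ℝ)) := by fun_prop
  have e1 : (fun x => chi ε (x, p.2)) =ᶠ[𝓝 p.1] fun _ => 1 := by
    filter_upwards [(c1.continuousAt (x := p.1)).eventually ho] with x hx using hone _ hx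
  have e2 : (fun y => chi ε (p.1, y)) =ᶠ[𝓝 p.2] fun _ => 1 := by
    filter_upwards [(c2.continuousAt (x := p.2)).eventually ho] with x hx using hone _ hx
  unfold remd lap2
  rw [e1.deriv.deriv_eq, e2.deriv.deriv_eq, e1.deriv_eq, e2.deriv_eq]
  simp

theorem remd_bound {φ : ℝ × ℝ → ℝ} (hφ : ContDiff ℝ 2 φ)
    (hφ0 : ∀ p ∈ triK \ equilateralTriangle, φ p = 0) :
    ∃ C : ℝ, 0 ≤ C ∧ ∀ ε : ℝ, 0 < ε → ∀ p ∈ strip ε, |remd ε φ p| ≤ C * ε⁻¹ := by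
  obtain ⟨C, hC, hb⟩ := chi_bounds
  obtain ⟨M, hM⟩ := isCompact_triK.exists_bound_of_continuousOn
    (hφ.continuous_fderiv (by norm_num)).continuousOn
  have hd : ∀ p, DifferentiableAt ℝ φ p := fun p => (hφ.differentiable (by norm_num)) p
  refine ⟨6 * C * |M|, by positivity, fun ε hε p hp => ?_⟩
  have hK : p ∈ triK := hp.1
  have hi : 0 < ε⁻¹ := by positivity
  have bφ : |φ p| ≤ |M| * (2 * ε) := by
    obtain ⟨q, hq, hpq⟩ := strip_near hp
    have := (convex_tri 0 0 1).norm_image_sub_le_of_norm_fderiv_le (𝕜 := ℝ) (f := φ) (C := M)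
      (fun x _ => hd x) (fun x hx => hM x hx) hq.1 hK
    rw [hφ0 q hq, sub_zero, Real.norm_eq_abs] at this
    refine this.trans ?_
    have := le_abs_self M
    gcongr
  have nf : ∀ v : ℝ × ℝ, ‖v‖ ≤ 1 → |fderiv ℝ φ p v| ≤ |M| := by
    intro v hv
    have h1 := (fderiv ℝ φ p).le_opNorm v
    have h2 := (hM p hK).trans (le_abs_self M)
    calc |fderiv ℝ φ p v| ≤ ‖fderiv ℝ φ p‖ * ‖v‖ := h1
      _ ≤ |M| * 1 := by gcongr
      _ = |M| := mul_one _
  obtain ⟨b1, b2, b3⟩ := hb ε hε p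
  unfold remd
  rw [deriv_slice_fst (hd p), deriv_slice_snd (hd p)]
  have n1 := nf (1, 0) (by simp [Prod.norm_def])
  have n2 := nf (0, 1) (by simp [Prod.norm_def])
  have t1 : |lap2 (chi ε) p * φ p| ≤ 2 * C * |M| * ε⁻¹ := by
    rw [abs_mul]
    calc _ ≤ (C * ε⁻¹ ^ 2) * (|M| * (2 * ε)) := by gcongr
      _ = 2 * C * |M| * ε⁻¹ := by field_simp
  have t2 : |deriv (fun x => chi ε (x, p.2)) p.1 * fderiv ℝ φ p (1, 0)| ≤ C * ε⁻¹ * |M| := by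
    rw [abs_mul]; gcongr
  have t3 : |deriv (fun y => chi ε (p.1, y)) p.2 * fderiv ℝ φ p (0, 1)| ≤ C * ε⁻¹ * |M| := by
    rw [abs_mul]; gcongr
  rw [abs_le] at t1 t2 t3 ⊢
  constructor <;> linarith

theorem trunc_identity {u φ : ℝ × ℝ → ℝ} {lam mu ε : ℝ} (hε : 0 < ε)
    (hu : ContDiffOn ℝ 2 u equilateralTriangle) (huc : ContinuousOn u triK)
    (hlap : ∀ p ∈ equilateralTriangle, lap2 u p = -lam * u p)
    (hφ : ContDiff ℝ 2 φ) (hφl : ∀ p, lap2 φ p = -mu * φ p) :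
    (mu - lam) * ∫ p in triK, u p * (chi ε p * φ p) = ∫ p in strip ε, u p * remd ε φ p := by
  set ψ : ℝ × ℝ → ℝ := fun p => chi ε p * φ p with hψdef
  have hψ : ContDiff ℝ 2 ψ := (chi_contDiff ε).mul hφ
  have hts : tsupport ψ ⊆ {p | ε ≤ cs p ∧ ε ≤ cr p ∧ cs p + cr p ≤ 1 - ε} := by
    apply closure_minimal _ (isClosed_tri _ _ _)
    intro p hp
    apply chi_support hε
    intro h
    apply hp
    simp [hψdef, h]
  have htE : tsupport ψ ⊆ equilateralTriangle := by
    rw [equi_eq]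
    intro p hp
    obtain ⟨h1, h2, h3⟩ := hts hp
    exact ⟨by linarith, by linarith, by linarith⟩
  have hc : HasCompactSupport ψ :=
    isCompact_triK.of_isClosed_subset (isClosed_tsupport ψ) (htE.trans equi_sub_K)
  have hz : ∀ p, p ∉ triK → ψ p = 0 := fun p hp =>
    image_eq_zero_of_notMem_tsupport (fun h => hp (equi_sub_K (htE h)))
  have hz2 : ∀ p, p ∉ triK → lap2 ψ p = 0 := by
    intro p hp
    have hpt : p ∉ tsupport ψ := fun h => hp (equi_sub_K (htE h))
    rw [lap2_eq isOpen_univ hψ.contDiffOn (mem_univ p)]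
    have : ∀ v, fderiv ℝ (fun q => fderiv ℝ ψ q v) p v = 0 := fun v =>
      image_eq_zero_of_notMem_tsupport (f := fun p => fderiv ℝ (fun q => fderiv ℝ ψ q v) p v)
        (fun h => hpt (((tsupport_fderiv_apply_subset ℝ v).trans
          (tsupport_fderiv_apply_subset ℝ v)) h))
    rw [this, this, add_zero]
  have hg := green isOpen_equi hu hψ hc htE
  have hr : ∫ p, lap2 u p * ψ p = -lam * ∫ p in triK, u p * ψ p := by
    rw [setIntegral_eq_integral_of_forall_compl_eq_zero (fun p hp => by rw [hz p hp, mul_zero]),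
      ← integral_const_mul]
    congr 1
    funext p
    by_cases hp : p ∈ equilateralTriangle
    · rw [hlap p hp]; ring
    · have : ψ p = 0 := image_eq_zero_of_notMem_tsupport (fun h => hp (htE h))
      simp [this]
  have hl : ∫ p, u p * lap2 ψ p = ∫ p in triK, u p * lap2 ψ p :=
    (setIntegral_eq_integral_of_forall_compl_eq_zero
      (fun p hp => by rw [hz2 p hp, mul_zero])).symm
  have hψl : Continuous (lap2 ψ) := by
    have : lap2 ψ = fun p => fderiv ℝ (fun q => fderiv ℝ ψ q (1, 0)) p (1, 0) +
      fderiv ℝ (fun q => fderiv ℝ ψ q (0, 1)) p (0, 1) := by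
      funext p
      exact lap2_eq isOpen_univ hψ.contDiffOn (mem_univ p)
    rw [this]
    have hψ2 : ∀ v, Continuous (fun p => fderiv ℝ (fun q => fderiv ℝ ψ q v) p v) := fun v =>
      (((hψ.fderiv_right (m := 1) (by norm_num)).clm_apply
        (contDiff_const (c := v))).continuous_fderiv (by norm_num)).clm_apply continuous_const
    exact (hψ2 _).add (hψ2 _)
  have hrem : ∀ p, remd ε φ p = lap2 ψ p + mu * ψ p := by
    intro p
    rw [hψdef, lap2_mul (chi_contDiff ε) hφ, hφl]
    unfold remd
    ring
  have hs : ∫ p in strip ε, u p * remd ε φ p = ∫ p in triK, u p * remd ε φ p := by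
    symm
    apply setIntegral_eq_of_subset_of_forall_sdiff_eq_zero (isClosed_tri 0 0 1).measurableSet
      inter_subset_left
    rintro p ⟨h1, h2⟩
    rw [remd_zero hε φ h1 h2, mul_zero]
  rw [hs]
  have i1 : IntegrableOn (fun p => u p * lap2 ψ p) triK :=
    (huc.mul hψl.continuousOn).integrableOn_compact isCompact_triK
  have i2 : IntegrableOn (fun p => mu * (u p * ψ p)) triK :=
    ((huc.mul hψ.continuous.continuousOn).integrableOn_compact isCompact_triK).const_mul mu
  have : ∫ p in triK, u p * remd ε φ p =
      ∫ p in triK, (u p * lap2 ψ p + mu * (u p * ψ p)) := by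
    congr 1
    funext p
    rw [hrem]; ring
  rw [this, integral_add i1 i2, ← hl, hg, hr, integral_const_mul]
  ring

theorem orth {u φ : ℝ × ℝ → ℝ} {lam mu : ℝ}
    (hu : ContDiffOn ℝ 2 u equilateralTriangle) (huc : ContinuousOn u triK)
    (hu0 : ∀ p ∈ triK \ equilateralTriangle, u p = 0)
    (hlap : ∀ p ∈ equilateralTriangle, lap2 u p = -lam * u p)
    (hφ : ContDiff ℝ 2 φ) (hφl : ∀ p, lap2 φ p = -mu * φ p)
    (hφ0 : ∀ p ∈ triK \ equilateralTriangle, φ p = 0) :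
    (mu - lam) * ∫ p in triK, u p * φ p = 0 := by
  have hK : MeasurableSet triK := (isClosed_tri 0 0 1).measurableSet
  have lim1 : Tendsto (fun ε : ℝ => ∫ p in triK, u p * (chi ε p * φ p)) (𝓝[>] 0)
      (𝓝 (∫ p in triK, u p * φ p)) := by
    apply tendsto_integral_filter_of_dominated_convergence (fun p => ‖u p * φ p‖)
    · filter_upwards with ε
      exact (huc.mul ((chi_contDiff ε).continuous.mul
        hφ.continuous).continuousOn).aestronglyMeasurable hK
    · filter_upwards with ε
      filter_upwards with p
      rw [show u p * (chi ε p * φ p) = chi ε p * (u p * φ p) by ring, norm_mul]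
      exact mul_le_of_le_one_left (norm_nonneg _) (chi_abs_le ε p)
    · exact ((huc.mul hφ.continuous.continuousOn).integrableOn_compact isCompact_triK).norm
    · filter_upwards [ae_restrict_mem hK] with p hp
      by_cases hpE : p ∈ equilateralTriangle
      · apply tendsto_const_nhds.congr'
        rw [equi_eq] at hpE
        obtain ⟨h1, h2, h3⟩ := hpE
        have hm : 0 < min (cs p) (min (cr p) (1 - cs p - cr p)) :=
          lt_min h1 (lt_min h2 (by linarith))
        have hIoo : Ioo (0 : ℝ) (min (cs p) (min (cr p) (1 - cs p - cr p)) / 2) ∈ 𝓝[>] (0 : ℝ) :=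
          Ioo_mem_nhdsGT (by linarith)
        filter_upwards [hIoo] with ε hε
        have l1 := min_le_left (cs p) (min (cr p) (1 - cs p - cr p))
        have l2 := min_le_right (cs p) (min (cr p) (1 - cs p - cr p))
        have l3 := min_le_left (cr p) (1 - cs p - cr p)
        have l4 := min_le_right (cr p) (1 - cs p - cr p)
        have := hε.2
        rw [chi_one hε.1 (by linarith) (by linarith) (by linarith), one_mul]
      · simp [hu0 p ⟨hp, hpE⟩]
  have lim2 : Tendsto (fun ε : ℝ => ∫ p in strip ε, u p * remd ε φ p) (𝓝[>] 0) (𝓝 0) := by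
    obtain ⟨C, hC, hb⟩ := remd_bound hφ hφ0
    rw [Metric.tendsto_nhds]
    intro δ hδ
    have huu := isCompact_triK.uniformContinuousOn_of_continuous huc
    rw [Metric.uniformContinuousOn_iff] at huu
    obtain ⟨η, hη, hh⟩ := huu (δ / (30 * C + 1)) (by positivity)
    have hIoo : Ioo (0 : ℝ) (η / 2) ∈ 𝓝[>] (0 : ℝ) := Ioo_mem_nhdsGT (by linarith)
    filter_upwards [hIoo] with ε hε
    have hε0 := hε.1
    have hvol := strip_volume hε0
    have hfin : volume (strip ε) < ⊤ := hvol.trans_lt ENNReal.ofReal_lt_top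
    have hpt : ∀ p ∈ strip ε, ‖u p * remd ε φ p‖ ≤ δ / (30 * C + 1) * (C * ε⁻¹) := by
      intro p hp
      rw [norm_mul]
      obtain ⟨q, hq, hpq⟩ := strip_near hp
      have h1 := hh p hp.1 q hq.1 (by rw [dist_eq_norm]; linarith [hε.2])
      rw [hu0 q hq, dist_zero_right] at h1
      have h2 := hb ε hε0 p hp
      rw [← Real.norm_eq_abs] at h2
      gcongr
    have h1 := norm_setIntegral_le_of_norm_le_const hfin hpt
    have h2 : volume.real (strip ε) ≤ 30 * ε := by
      rw [Measure.real]
      exact ENNReal.toReal_le_of_le_ofReal (by positivity) hvol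
    rw [dist_zero_right]
    refine h1.trans_lt ?_
    calc δ / (30 * C + 1) * (C * ε⁻¹) * volume.real (strip ε)
        ≤ δ / (30 * C + 1) * (C * ε⁻¹) * (30 * ε) := by gcongr
      _ = δ * (30 * C / (30 * C + 1)) := by field_simp
      _ < δ * 1 := by
          gcongr
          rw [div_lt_one (by positivity)]; linarith
      _ = δ := mul_one δ
  have lim3 := lim1.const_mul (mu - lam)
  have : (fun ε : ℝ => ∫ p in strip ε, u p * remd ε φ p) =ᶠ[𝓝[>] 0]
      fun ε => (mu - lam) * ∫ p in triK, u p * (chi ε p * φ p) := by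
    filter_upwards [self_mem_nhdsWithin] with ε hε
    exact (trunc_identity hε hu huc hlap hφ hφl).symm
  exact tendsto_nhds_unique lim3 (lim2.congr' this)

end Orth

section Trig
open Set Filter Topology

noncomputable def t₁ (p : ℝ × ℝ) : ℝ := 2 * p.1 / 3
noncomputable def t₂ (p : ℝ × ℝ) : ℝ := (Real.sqrt 3 * p.2 - p.1) / 3
noncomputable def t₃ (p : ℝ × ℝ) : ℝ := -(p.1 + Real.sqrt 3 * p.2) / 3

theorem t_sum (p : ℝ × ℝ) : t₁ p + t₂ p + t₃ p = 0 := by unfold t₁ t₂ t₃; ring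
theorem t_cs (p : ℝ × ℝ) : t₁ p - t₂ p = cs p := by unfold t₁ t₂ cs; ring
theorem t_cr (p : ℝ × ℝ) : t₂ p - t₃ p = cr p := by unfold t₂ t₃ cr; ring

/-- The phase of an exponential. -/
noncomputable def phase (a b c : ℤ) (p : ℝ × ℝ) : ℝ :=
  2 * Real.pi * (a * t₁ p + b * t₂ p + c * t₃ p)

/-- Exponentials. -/
noncomputable def W (a b c : ℤ) (p : ℝ × ℝ) : ℂ := Complex.exp ((phase a b c p : ℝ) * Complex.I)

theorem W_mul (a b c a' b' c' : ℤ) (p : ℝ × ℝ) :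
    W a b c p * W a' b' c' p = W (a + a') (b + b') (c + c') p := by
  unfold W
  rw [← Complex.exp_add]
  congr 1
  unfold phase
  push_cast
  ring

theorem W_continuous (a b c : ℤ) : Continuous (W a b c) := by
  unfold W phase t₁ t₂ t₃
  fun_prop

theorem W_conj (a b c : ℤ) (p : ℝ × ℝ) : (starRingEnd ℂ) (W a b c p) = W (-a) (-b) (-c) p := by
  unfold W
  rw [← Complex.exp_conj]
  congr 1
  simp only [map_mul, Complex.conj_ofReal, Complex.conj_I]
  unfold phase
  push_cast
  ring

theorem W_eq_of {a b c a' b' c' : ℤ} {p : ℝ × ℝ} (k : ℤ)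
    (h : (a * t₁ p + b * t₂ p + c * t₃ p) = (a' * t₁ p + b' * t₂ p + c' * t₃ p) + k) :
    W a b c p = W a' b' c' p := by
  unfold W
  rw [Complex.exp_eq_exp_iff_exists_int]
  refine ⟨k, ?_⟩
  unfold phase
  rw [h]
  push_cast
  ring

theorem W_eq_iff {a b c a' b' c' : ℤ} {p q : ℝ × ℝ} (h : W a b c p = W a' b' c' q) :
    ∃ k : ℤ, (a * t₁ p + b * t₂ p + c * t₃ p) = (a' * t₁ q + b' * t₂ q + c' * t₃ q) + k := by
  unfold W at h
  rw [Complex.exp_eq_exp_iff_exists_int] at h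
  obtain ⟨k, hk⟩ := h
  refine ⟨k, ?_⟩
  have hk2 : ((phase a b c p : ℝ) : ℂ) = ((phase a' b' c' q + k * (2 * Real.pi) : ℝ) : ℂ) := by
    have : (((phase a b c p : ℝ) : ℂ) - ((phase a' b' c' q + k * (2 * Real.pi) : ℝ) : ℂ))
        * Complex.I = 0 := by
      rw [sub_mul, hk]; push_cast; ring
    rcases mul_eq_zero.1 this with h | h
    · exact sub_eq_zero.1 h
    · exact absurd h Complex.I_ne_zero
  have hk3 := Complex.ofReal_injective hk2
  unfold phase at hk3
  have hpi : (2 * Real.pi) ≠ 0 := by positivity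
  apply mul_left_cancel₀ hpi
  linarith

/-- Alternating sums of exponentials. -/
noncomputable def D (a b c : ℤ) (p : ℝ × ℝ) : ℂ :=
  W a b c p + W b c a p + W c a b p - W b a c p - W a c b p - W c b a p

theorem D_continuous (a b c : ℤ) : Continuous (D a b c) := by
  unfold D
  have := W_continuous
  fun_prop

theorem D_zero_cs {p : ℝ × ℝ} {k : ℤ} (h : cs p = k) (a b c : ℤ) : D a b c p = 0 := by
  rw [← t_cs] at h
  have key : ∀ a b c : ℤ, W a b c p = W b a c p := fun a b c =>
    W_eq_of ((a - b) * k) (by push_cast; rw [← h]; ring)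
  unfold D
  rw [key a b c, key b c a, key c a b]; ring

theorem D_zero_cr {p : ℝ × ℝ} {k : ℤ} (h : cr p = k) (a b c : ℤ) : D a b c p = 0 := by
  rw [← t_cr] at h
  have key : ∀ a b c : ℤ, W a b c p = W a c b p := fun a b c =>
    W_eq_of ((b - c) * k) (by push_cast; rw [← h]; ring)
  unfold D
  rw [key a b c, key b c a, key c a b]; ring

theorem D_zero_sum {p : ℝ × ℝ} {k : ℤ} (h : cs p + cr p = k) (a b c : ℤ) : D a b c p = 0 := by
  rw [← t_cr, ← t_cs] at h
  have key : ∀ a b c : ℤ, W a b c p = W c b a p := fun a b c =>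
    W_eq_of ((a - c) * k) (by push_cast; rw [← h]; ring)
  unfold D
  rw [key a b c, key b c a, key c a b]; ring

/-- Symmetric sum. -/
noncomputable def Z (p : ℝ × ℝ) : ℂ := W 1 0 0 p + W 0 1 0 p + W 0 0 1 p

theorem Z_conj (p : ℝ × ℝ) : (starRingEnd ℂ) (Z p) = W (-1) 0 0 p + W 0 (-1) 0 p + W 0 0 (-1) p := by
  unfold Z
  simp only [map_add, W_conj, neg_zero]

theorem Z_mul_D (a b c : ℤ) (p : ℝ × ℝ) :
    Z p * D a b c p = D (a + 1) b c p + D a (b + 1) c p + D a b (c + 1) p := by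
  unfold D Z
  simp only [add_mul, mul_sub, mul_add, W_mul, zero_add, add_comm (1 : ℤ)]
  ring

theorem Zc_mul_D (a b c : ℤ) (p : ℝ × ℝ) :
    (starRingEnd ℂ) (Z p) * D a b c p =
      D (a + -1) b c p + D a (b + -1) c p + D a b (c + -1) p := by
  rw [Z_conj]
  unfold D
  simp only [add_mul, mul_sub, mul_add, W_mul, zero_add, add_comm (-1 : ℤ)]
  ring

theorem W_ne {p : ℝ × ℝ} (hp : p ∈ equilateralTriangle) :
    W 1 0 0 p ≠ W 0 1 0 p ∧ W 1 0 0 p ≠ W 0 0 1 p ∧ W 0 1 0 p ≠ W 0 0 1 p := by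
  rw [equi_eq] at hp
  obtain ⟨h1, h2, h3⟩ := hp
  have e1 := t_cs p
  have e2 := t_cr p
  have noint : ∀ (x : ℝ) (k : ℤ), 0 < x → x < 1 → x = k → False := by
    intro x k a b c
    rw [c] at a b
    have a' : 0 < k := by exact_mod_cast a
    have b' : k < 1 := by exact_mod_cast b
    omega
  refine ⟨fun h => ?_, fun h => ?_, fun h => ?_⟩
  · obtain ⟨k, hk⟩ := W_eq_iff h
    push_cast at hk
    exact noint (cs p) k h1 (by linarith) (by linarith)
  · obtain ⟨k, hk⟩ := W_eq_iff h
    push_cast at hk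
    exact noint (cs p + cr p) k (by linarith) (by linarith) (by linarith)
  · obtain ⟨k, hk⟩ := W_eq_iff h
    push_cast at hk
    exact noint (cr p) k h2 (by linarith) (by linarith)

theorem D_ne {p : ℝ × ℝ} (hp : p ∈ equilateralTriangle) : D 2 1 0 p ≠ 0 := by
  obtain ⟨h1, h2, h3⟩ := W_ne hp
  have : D 2 1 0 p = (W 1 0 0 p - W 0 1 0 p) * (W 1 0 0 p - W 0 0 1 p) *
      (W 0 1 0 p - W 0 0 1 p) := by
    unfold D
    simp only [mul_sub, sub_mul, W_mul]
    norm_num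
    ring
  rw [this]
  exact mul_ne_zero (mul_ne_zero (sub_ne_zero.2 h1) (sub_ne_zero.2 h2)) (sub_ne_zero.2 h3)

theorem cubic_perm {A B C A' B' C' : ℂ} (h1 : A + B + C = A' + B' + C')
    (h2 : A * B + B * C + C * A = A' * B' + B' * C' + C' * A') (h3 : A * B * C = A' * B' * C') :
    (A' = A ∧ B' = B ∧ C' = C) ∨ (A' = A ∧ B' = C ∧ C' = B) ∨ (A' = B ∧ B' = A ∧ C' = C) ∨
    (A' = B ∧ B' = C ∧ C' = A) ∨ (A' = C ∧ B' = A ∧ C' = B) ∨ (A' = C ∧ B' = B ∧ C' = A) := by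
  have hr : (A' - A) * ((A' - B) * (A' - C)) = 0 := by
    linear_combination (-A' ^ 2) * h1 + A' * h2 - h3
  have hr' : (B' - A) * ((B' - B) * (B' - C)) = 0 := by
    linear_combination (-B' ^ 2) * h1 + B' * h2 - h3
  have two : ∀ x y x' y' : ℂ, ∀ z : ℂ, x + y + z = x' + y' + z →
      x * y + (x + y) * z = x' * y' + (x' + y') * z →
      (x' = x ∧ y' = y) ∨ (x' = y ∧ y' = x) := by
    intro x y x' y' z hs hp
    have hs' : x + y = x' + y' := by linear_combination hs
    have hp' : x * y = x' * y' := by linear_combination hp - z * hs'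
    have : (x' - x) * (x' - y) = 0 := by linear_combination (-x') * hs' + hp'
    rcases mul_eq_zero.1 this with h | h
    · left
      have h := sub_eq_zero.1 h
      exact ⟨h, by rw [h] at hs'; linear_combination -hs'⟩
    · right
      have h := sub_eq_zero.1 h
      exact ⟨h, by rw [h] at hs'; linear_combination -hs'⟩
  rcases mul_eq_zero.1 hr with h | h
  · have h := sub_eq_zero.1 h
    subst h
    rcases two B C B' C' A' (by linear_combination h1) (by linear_combination h2) with h | h
    · left; exact ⟨rfl, h⟩
    · right; left; exact ⟨rfl, h⟩
  rcases mul_eq_zero.1 h with h | h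
  · have h := sub_eq_zero.1 h
    subst h
    rcases two A C B' C' A' (by linear_combination h1) (by linear_combination h2) with h | h
    · right; right; left; exact ⟨rfl, h⟩
    · right; right; right; left; exact ⟨rfl, h⟩
  · have h := sub_eq_zero.1 h
    subst h
    rcases two A B B' C' A' (by linear_combination h1) (by linear_combination h2) with h | h
    · right; right; right; right; left; exact ⟨rfl, h⟩
    · right; right; right; right; right; exact ⟨rfl, h⟩

theorem alcove_unique {a b c a' b' c' x y z : ℝ} (h : a + b + c = 0) (h1 : b ≤ a) (h2 : c ≤ b)
    (h3 : a ≤ c + 1) (h' : a' + b' + c' = 0) (h1' : b' ≤ a') (h2' : c' ≤ b') (h3' : a' ≤ c' + 1)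
    (hp : (x = a ∧ y = b ∧ z = c) ∨ (x = a ∧ y = c ∧ z = b) ∨ (x = b ∧ y = a ∧ z = c) ∨
      (x = b ∧ y = c ∧ z = a) ∨ (x = c ∧ y = a ∧ z = b) ∨ (x = c ∧ y = b ∧ z = a))
    {k l m : ℤ} (hk : a' = x + k) (hl : b' = y + l) (hm : c' = z + m) : a' = a ∧ b' = b := by
  have hx : x ≤ 2 / 3 ∧ -(2 / 3) ≤ x ∧ y ≤ 2 / 3 ∧ -(2 / 3) ≤ y ∧ x + y + z = 0 := by
    rcases hp with ⟨rfl, rfl, rfl⟩ | ⟨rfl, rfl, rfl⟩ | ⟨rfl, rfl, rfl⟩ | ⟨rfl, rfl, rfl⟩ |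
      ⟨rfl, rfl, rfl⟩ | ⟨rfl, rfl, rfl⟩ <;>
    refine ⟨by linarith, by linarith, by linarith, by linarith, by linarith⟩
  obtain ⟨x1, x2, y1, y2, hs⟩ := hx
  have hm' : m = -k - l := by
    have : (m : ℝ) = ((-k - l : ℤ) : ℝ) := by push_cast; linarith
    exact_mod_cast this
  subst hm'
  have k1 : k < 2 := by
    have : (k : ℝ) < (2 : ℤ) := by push_cast; linarith
    exact_mod_cast this
  have k2 : -2 < k := by
    have : ((-2 : ℤ) : ℝ) < k := by push_cast; linarith
    exact_mod_cast this
  have l1 : l < 2 := by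
    have : (l : ℝ) < (2 : ℤ) := by push_cast; linarith
    exact_mod_cast this
  have l2 : -2 < l := by
    have : ((-2 : ℤ) : ℝ) < l := by push_cast; linarith
    exact_mod_cast this
  push_cast at hm
  interval_cases k <;> interval_cases l <;> push_cast at hk hl hm <;>
    rcases hp with ⟨rfl, rfl, rfl⟩ | ⟨rfl, rfl, rfl⟩ | ⟨rfl, rfl, rfl⟩ | ⟨rfl, rfl, rfl⟩ |
      ⟨rfl, rfl, rfl⟩ | ⟨rfl, rfl, rfl⟩ <;>
    constructor <;> linarith

theorem Z_inj {p q : ℝ × ℝ} (hp : p ∈ triK) (hq : q ∈ triK) (h : Z p = Z q) : p = q := by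
  have prod1 : ∀ p, W 1 0 0 p * W 0 1 0 p * W 0 0 1 p = 1 := by
    intro p
    simp only [W_mul]
    have : phase 1 1 1 p = 0 := by unfold phase; push_cast; linear_combination 2 * Real.pi * t_sum p
    norm_num [W, this]
  have e2 : ∀ p, W 1 0 0 p * W 0 1 0 p + W 0 1 0 p * W 0 0 1 p + W 0 0 1 p * W 1 0 0 p =
      (starRingEnd ℂ) (Z p) := by
    intro p
    rw [Z_conj]
    simp only [W_mul]
    have s := t_sum p
    have r1 : W 1 1 0 p = W 0 0 (-1) p := W_eq_of 0 (by push_cast; linarith)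
    have r2 : W 0 1 1 p = W (-1) 0 0 p := W_eq_of 0 (by push_cast; linarith)
    have r3 : W 1 0 1 p = W 0 (-1) 0 p := W_eq_of 0 (by push_cast; linarith)
    norm_num
    rw [r1, r2, r3]; ring
  have hperm := cubic_perm (A := W 1 0 0 p) (B := W 0 1 0 p) (C := W 0 0 1 p)
    (A' := W 1 0 0 q) (B' := W 0 1 0 q) (C' := W 0 0 1 q) h
    (by rw [e2, e2, h]) (by rw [prod1, prod1])
  obtain ⟨p1, p2, p3⟩ := hp
  obtain ⟨q1, q2, q3⟩ := hq
  rw [← t_cs] at p1 p3 q1 q3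
  rw [← t_cr] at p2 p3 q2 q3
  have fin : t₁ q = t₁ p ∧ t₂ q = t₂ p := by
    have U := fun x y z hxyz k l m => @alcove_unique (t₁ p) (t₂ p) (t₃ p) (t₁ q) (t₂ q) (t₃ q)
      x y z (t_sum p) (by linarith) (by linarith) (by linarith) (t_sum q) (by linarith)
      (by linarith) (by linarith) hxyz k l m
    rcases hperm with ⟨a, b, c⟩ | ⟨a, b, c⟩ | ⟨a, b, c⟩ | ⟨a, b, c⟩ | ⟨a, b, c⟩ | ⟨a, b, c⟩ <;>
    obtain ⟨k, hk⟩ := W_eq_iff a <;> obtain ⟨l, hl⟩ := W_eq_iff b <;>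
    obtain ⟨m, hm⟩ := W_eq_iff c <;>
    push_cast at hk hl hm <;>
    simp only [one_mul, zero_mul, add_zero, zero_add] at hk hl hm
    · exact U _ _ _ (Or.inl ⟨rfl, rfl, rfl⟩) k l m hk hl hm
    · exact U _ _ _ (Or.inr (Or.inl ⟨rfl, rfl, rfl⟩)) k l m hk hl hm
    · exact U _ _ _ (Or.inr (Or.inr (Or.inl ⟨rfl, rfl, rfl⟩))) k l m hk hl hm
    · exact U _ _ _ (Or.inr (Or.inr (Or.inr (Or.inl ⟨rfl, rfl, rfl⟩)))) k l m hk hl hm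
    · exact U _ _ _ (Or.inr (Or.inr (Or.inr (Or.inr (Or.inl ⟨rfl, rfl, rfl⟩))))) k l m hk hl hm
    · exact U _ _ _ (Or.inr (Or.inr (Or.inr (Or.inr (Or.inr ⟨rfl, rfl, rfl⟩))))) k l m hk hl hm
  have s1 := t_sum p
  have s2 := t_sum q
  apply pt_ext
  · rw [← t_cs, ← t_cs, fin.1, fin.2]
  · rw [← t_cr, ← t_cr]; linarith [fin.1, fin.2]

/-- Smooth solutions of the Helmholtz equation on the plane. -/
def Helm (mu : ℝ) (φ : ℝ × ℝ → ℝ) : Prop :=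
  ContDiff ℝ 2 φ ∧ ∀ p, lap2 φ p = -mu * φ p

theorem lap2_add {f g : ℝ × ℝ → ℝ} (hf : ContDiff ℝ 2 f) (hg : ContDiff ℝ 2 g) (c : ℝ)
    (p : ℝ × ℝ) : lap2 (fun q => f q + c * g q) p = lap2 f p + c * lap2 g p := by
  have one : ∀ {f g : ℝ → ℝ}, ContDiff ℝ 2 f → ContDiff ℝ 2 g → ∀ x,
      deriv (deriv fun x => f x + c * g x) x = deriv (deriv f) x + c * deriv (deriv g) x := by
    intro f g hf hg x
    have f1 : Differentiable ℝ f := hf.differentiable (by norm_num)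
    have g1 : Differentiable ℝ g := hg.differentiable (by norm_num)
    have f2 : Differentiable ℝ (deriv f) := (contDiff_deriv_one hf).differentiable (by norm_num)
    have g2 : Differentiable ℝ (deriv g) := (contDiff_deriv_one hg).differentiable (by norm_num)
    have e : deriv (fun x => f x + c * g x) = fun x => deriv f x + c * deriv g x := by
      funext x
      exact ((f1 x).hasDerivAt.add ((g1 x).hasDerivAt.const_mul c)).deriv
    rw [e]
    exact ((f2 x).hasDerivAt.add ((g2 x).hasDerivAt.const_mul c)).deriv
  unfold lap2
  rw [one (slice_contDiff_x hf p.2) (slice_contDiff_x hg p.2),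
    one (slice_contDiff_y hf p.1) (slice_contDiff_y hg p.1)]
  ring

theorem Helm.add {mu : ℝ} {f g : ℝ × ℝ → ℝ} (hf : Helm mu f) (hg : Helm mu g) (c : ℝ) :
    Helm mu (fun q => f q + c * g q) := by
  refine ⟨hf.1.add (contDiff_const.mul hg.1), fun p => ?_⟩
  rw [lap2_add hf.1 hg.1, hf.2, hg.2]; ring

theorem helm_cos (a b d : ℝ) : Helm (a ^ 2 + b ^ 2) (fun p => Real.cos (a * p.1 + b * p.2 + d)) := by
  constructor
  · fun_prop
  · intro p
    have one : ∀ k e x : ℝ, deriv (deriv fun x => Real.cos (k * x + e)) x =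
        - k ^ 2 * Real.cos (k * x + e) := by
      intro k e x
      have l : ∀ x, HasDerivAt (fun x => k * x + e) k x := fun x => by
        simpa using ((hasDerivAt_id x).const_mul k).add_const e
      have e1 : deriv (fun x => Real.cos (k * x + e)) = fun x => -Real.sin (k * x + e) * k := by
        funext x; exact ((l x).cos).deriv
      rw [e1]
      have := (((l x).sin.neg).mul_const k).deriv
      refine Eq.trans this ?_
      ring
    unfold lap2
    have e1 : (fun x => Real.cos (a * x + b * p.2 + d)) =
        fun x => Real.cos (a * x + (b * p.2 + d)) := by
      funext x; rw [add_assoc]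
    have e2 : (fun y => Real.cos (a * p.1 + b * y + d)) =
        fun y => Real.cos (b * y + (a * p.1 + d)) := by
      funext y; congr 1; ring
    simp only
    rw [e1, e2, one, one, show a * p.1 + (b * p.2 + d) = a * p.1 + b * p.2 + d by ring,
      show b * p.2 + (a * p.1 + d) = a * p.1 + b * p.2 + d by ring]
    ring

/-- The eigenvalue attached to a triple of integers. -/
noncomputable def muOf (a b c : ℤ) : ℝ :=
  16 * Real.pi ^ 2 / 9 * (a ^ 2 + b ^ 2 + c ^ 2 - a * b - a * c - b * c)

theorem helm_phase (a b c : ℤ) (d : ℝ) :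
    Helm (muOf a b c) (fun p => Real.cos (phase a b c p + d)) := by
  have h := helm_cos (2 * Real.pi * (2 * a - b - c) / 3) (2 * Real.pi * Real.sqrt 3 * (b - c) / 3) d
  have e : (2 * Real.pi * (2 * a - b - c) / 3) ^ 2 +
      (2 * Real.pi * Real.sqrt 3 * (b - c) / 3) ^ 2 = muOf a b c := by
    unfold muOf
    linear_combination (4 * Real.pi ^ 2 * (b - c) ^ 2 / 9 : ℝ) * sqrt3_sq
  rw [e] at h
  convert h using 3 with p
  unfold phase t₁ t₂ t₃
  ring

/-- Real trigonometric alternating sums with a phase shift. -/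
noncomputable def R (a b c : ℤ) (d : ℝ) (p : ℝ × ℝ) : ℝ :=
  Real.cos (phase a b c p + d) + 1 * Real.cos (phase b c a p + d) +
    1 * Real.cos (phase c a b p + d) + (-1) * Real.cos (phase b a c p + d) +
    (-1) * Real.cos (phase a c b p + d) + (-1) * Real.cos (phase c b a p + d)

theorem helm_R (a b c : ℤ) (d : ℝ) : Helm (muOf a b c) (R a b c d) := by
  have h1 := helm_phase a b c d
  have h2 := helm_phase b c a d
  have h3 := helm_phase c a b d
  have h4 := helm_phase b a c d
  have h5 := helm_phase a c b d
  have h6 := helm_phase c b a d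
  rw [show muOf b c a = muOf a b c by unfold muOf; ring] at h2
  rw [show muOf c a b = muOf a b c by unfold muOf; ring] at h3
  rw [show muOf b a c = muOf a b c by unfold muOf; ring] at h4
  rw [show muOf a c b = muOf a b c by unfold muOf; ring] at h5
  rw [show muOf c b a = muOf a b c by unfold muOf; ring] at h6
  exact ((((h1.add h2 1).add h3 1).add h4 (-1)).add h5 (-1)).add h6 (-1)

theorem W_re (a b c : ℤ) (p : ℝ × ℝ) : (W a b c p).re = Real.cos (phase a b c p + 0) := by
  unfold W
  rw [Complex.exp_ofReal_mul_I_re, add_zero]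

theorem W_im (a b c : ℤ) (p : ℝ × ℝ) :
    (W a b c p).im = Real.cos (phase a b c p + -(Real.pi / 2)) := by
  unfold W
  rw [Complex.exp_ofReal_mul_I_im, ← sub_eq_add_neg, Real.cos_sub_pi_div_two]

theorem D_re (a b c : ℤ) (p : ℝ × ℝ) : (D a b c p).re = R a b c 0 p := by
  unfold D R
  simp only [Complex.add_re, Complex.sub_re, W_re]
  ring

theorem D_im (a b c : ℤ) (p : ℝ × ℝ) : (D a b c p).im = R a b c (-(Real.pi / 2)) p := by
  unfold D R
  simp only [Complex.add_im, Complex.sub_im, W_im]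
  ring

end Trig

section Complete
open Set Filter Topology MeasureTheory

theorem measurableSet_triK : MeasurableSet triK := isCompact_triK.isClosed.measurableSet

/-- Restriction of `D a b c` to the closed triangle. -/
noncomputable def DK (a b c : ℤ) : C(triK, ℂ) :=
  ⟨fun p => D a b c p, (D_continuous a b c).comp continuous_subtype_val⟩

theorem Z_continuous : Continuous Z := by
  unfold Z
  exact ((W_continuous _ _ _).add (W_continuous _ _ _)).add (W_continuous _ _ _)

noncomputable def ZK : C(triK, ℂ) := ⟨fun p => Z p, Z_continuous.comp continuous_subtype_val⟩

noncomputable def MK : Submodule ℂ C(triK, ℂ) :=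
  Submodule.span ℂ {f | ∃ a b c, f = DK a b c}

theorem DK_mem (a b c : ℤ) : DK a b c ∈ MK := Submodule.subset_span ⟨a, b, c, rfl⟩

theorem mul_MK {g : C(triK, ℂ)} (hg : ∀ a b c, g * DK a b c ∈ MK) :
    ∀ m ∈ MK, g * m ∈ MK := by
  intro m hm
  refine Submodule.span_induction (p := fun m _ => g * m ∈ MK) ?_ ?_ ?_ ?_ hm
  · rintro x ⟨a, b, c, rfl⟩
    exact hg a b c
  · simp
  · intro x y _ _ hx hy
    rw [mul_add]
    exact MK.add_mem hx hy
  · intro r x _ hx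
    rw [mul_smul_comm]
    exact MK.smul_mem r hx

theorem adjoin_mul_MK {f : C(triK, ℂ)} (hf : f ∈ StarAlgebra.adjoin ℂ {ZK}) :
    ∀ m ∈ MK, f * m ∈ MK := by
  have hf' : f ∈ Algebra.adjoin ℂ (({ZK} : Set C(triK, ℂ)) ∪ star {ZK}) := hf
  refine Algebra.adjoin_induction (p := fun f _ => ∀ m ∈ MK, f * m ∈ MK) ?_ ?_ ?_ ?_ hf'
  · intro x hx
    rcases hx with hx | hx
    · rw [mem_singleton_iff] at hx
      subst hx
      apply mul_MK
      intro a b c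
      have : ZK * DK a b c = DK (a+1) b c + DK a (b+1) c + DK a b (c+1) := by
        ext p
        exact Z_mul_D a b c p
      rw [this]
      exact MK.add_mem (MK.add_mem (DK_mem _ _ _) (DK_mem _ _ _)) (DK_mem _ _ _)
    · rw [Set.mem_star, mem_singleton_iff] at hx
      have hx : x = star ZK := by rw [← hx, star_star]
      subst hx
      apply mul_MK
      intro a b c
      have : star ZK * DK a b c = DK (a + -1) b c + DK a (b + -1) c + DK a b (c + -1) := by
        ext p
        exact Zc_mul_D a b c p
      rw [this]
      exact MK.add_mem (MK.add_mem (DK_mem _ _ _) (DK_mem _ _ _)) (DK_mem _ _ _)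
  · intro r m hm
    rw [Algebra.algebraMap_eq_smul_one, smul_mul_assoc, one_mul]
    exact MK.smul_mem r hm
  · intro x y _ _ hx hy m hm
    rw [add_mul]
    exact MK.add_mem (hx m hm) (hy m hm)
  · intro x y _ _ hx hy m hm
    rw [mul_assoc]
    exact hx _ (hy m hm)

noncomputable def nuK : Measure triK := Measure.comap Subtype.val volume

instance : CompactSpace triK := isCompact_iff_compactSpace.mp isCompact_triK

instance : IsFiniteMeasure nuK := by
  constructor
  rw [nuK, comap_subtype_coe_apply measurableSet_triK]
  simpa using isCompact_triK.measure_lt_top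

theorem nuK_integrable (f : C(triK, ℂ)) : Integrable f nuK := by
  refine Integrable.of_bound f.continuous.aestronglyMeasurable ‖f‖ ?_
  exact Eventually.of_forall f.norm_coe_le_norm

noncomputable def LK : C(triK, ℂ) →L[ℂ] ℂ :=
  LinearMap.mkContinuous
    { toFun := fun f => ∫ x, f x ∂nuK
      map_add' := fun f g => integral_add (nuK_integrable f) (nuK_integrable g)
      map_smul' := fun r f => integral_const_mul r _ } (nuK.real univ)
    (fun f => by
      rw [mul_comm]
      exact norm_integral_le_of_norm_le_const (Eventually.of_forall f.norm_coe_le_norm))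

theorem LK_apply (f : C(triK, ℂ)) : LK f = ∫ x, f x ∂nuK := rfl

theorem complete {u : ℝ × ℝ → ℝ} (hu : ContinuousOn u triK)
    (h : ∀ a b c, ∫ p in triK, (u p : ℂ) * D a b c p = 0) :
    ∀ p ∈ equilateralTriangle, u p = 0 := by
  let U : C(triK, ℂ) := ⟨fun p => (u p : ℂ),
    Complex.continuous_ofReal.comp (continuousOn_iff_continuous_domRestrict.mp hu)⟩
  have h1 : ∀ m ∈ MK, LK (U * m) = 0 := by
    intro m hm
    refine Submodule.span_induction (p := fun m _ => LK (U * m) = 0) ?_ ?_ ?_ ?_ hm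
    · rintro x ⟨a, b, c, rfl⟩
      rw [← h a b c, LK_apply]
      exact integral_subtype_comap measurableSet_triK (fun p => (u p : ℂ) * D a b c p)
    · simp
    · intro x y _ _ hx hy
      rw [mul_add, map_add, hx, hy, add_zero]
    · intro r x _ hx
      rw [mul_smul_comm, map_smul, hx, smul_zero]
  have htop : (StarAlgebra.adjoin ℂ {ZK}).topologicalClosure = ⊤ := by
    apply ContinuousMap.starSubalgebra_topologicalClosure_eq_top_of_separatesPoints
    intro x y hxy
    refine ⟨_, ⟨ZK, StarAlgebra.self_mem_adjoin_singleton ℂ ZK, rfl⟩, ?_⟩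
    intro hz
    exact hxy (Subtype.ext (Z_inj x.2 y.2 hz))
  have h2 : ∀ f : C(triK, ℂ), LK (U * (f * DK 2 1 0)) = 0 := by
    intro f
    have hf : f ∈ (StarAlgebra.adjoin ℂ {ZK}).topologicalClosure := by rw [htop]; trivial
    have hf' : f ∈ closure ((StarAlgebra.adjoin ℂ {ZK} : StarSubalgebra ℂ C(triK, ℂ)) :
      Set C(triK, ℂ)) := hf
    have hcl : IsClosed {f : C(triK, ℂ) | LK (U * (f * DK 2 1 0)) = 0} :=
      isClosed_eq (LK.continuous.comp (continuous_const.mul (continuous_id.mul continuous_const)))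
        continuous_const
    refine closure_minimal ?_ hcl hf'
    intro g hg
    exact h1 _ (adjoin_mul_MK hg _ (DK_mem _ _ _))
  have h3 := h2 (star (U * DK 2 1 0))
  have h4 : ∫ p in triK, (u p) ^ 2 * Complex.normSq (D 2 1 0 p) = 0 := by
    rw [LK_apply] at h3
    rw [← Complex.ofReal_inj, ← integral_complex_ofReal, Complex.ofReal_zero, ← h3]
    rw [← integral_subtype_comap measurableSet_triK]
    refine integral_congr_ae (Eventually.of_forall fun p => ?_)
    show (((u p) ^ 2 * Complex.normSq (D 2 1 0 p) : ℝ) : ℂ)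
      = (u p : ℂ) * ((starRingEnd ℂ) ((u p : ℂ) * D 2 1 0 p) * D 2 1 0 p)
    rw [map_mul, Complex.conj_ofReal, Complex.ofReal_mul, Complex.normSq_eq_conj_mul_self]
    push_cast
    ring
  have hc : ContinuousOn (fun p => (u p) ^ 2 * Complex.normSq (D 2 1 0 p)) triK :=
    (hu.pow 2).mul (Complex.continuous_normSq.comp (D_continuous 2 1 0)).continuousOn
  rw [setIntegral_eq_zero_iff_of_nonneg_ae (Eventually.of_forall fun p =>
    mul_nonneg (sq_nonneg _) (Complex.normSq_nonneg _))
    (hc.integrableOn_compact isCompact_triK)] at h4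
  have h5 := Measure.eqOn_open_of_ae_eq (ae_restrict_of_ae_restrict_of_subset equi_sub_K h4)
    isOpen_equi (hc.mono equi_sub_K) continuousOn_const
  intro p hp
  have h6 : (u p) ^ 2 * Complex.normSq (D 2 1 0 p) = 0 := h5 hp
  rcases mul_eq_zero.mp h6 with h7 | h7
  · exact pow_eq_zero_iff (two_ne_zero) |>.mp h7
  · exact absurd (Complex.normSq_eq_zero.mp h7) (D_ne hp)

theorem final_aux {u : ℝ × ℝ → ℝ} {lam : ℝ} (huc : ContinuousOn u triK)
    (hu : ContDiffOn ℝ 2 u equilateralTriangle)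
    (hu0 : ∀ p ∈ triK \ equilateralTriangle, u p = 0)
    (hlap : ∀ p ∈ equilateralTriangle, lap2 u p = -lam * u p)
    {a b c : ℤ} {d : ℝ} (hR : ∀ p, D a b c p = 0 → R a b c d p = 0)
    (hintne : ∫ p in triK, u p * R a b c d p ≠ 0) : IsDirichletEigenvalue hexagram lam := by
  obtain ⟨hφ, hφl⟩ := helm_R a b c d
  have hφ0 : ∀ p ∈ triK \ equilateralTriangle, R a b c d p = 0 := by
    rintro p ⟨⟨h1, h2, h3⟩, h4⟩
    apply hR
    rw [equi_eq] at h4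
    by_cases e1 : cs p = 0
    · exact D_zero_cs (k := 0) (by simpa using e1) a b c
    by_cases e2 : cr p = 0
    · exact D_zero_cr (k := 0) (by simpa using e2) a b c
    refine D_zero_sum (k := 1) ?_ a b c
    by_contra e3
    push_cast at e3
    exact h4 ⟨lt_of_le_of_ne h1 (Ne.symm e1), lt_of_le_of_ne h2 (Ne.symm e2),
      lt_of_le_of_ne h3 e3⟩
  have hmu : muOf a b c = lam := by
    have := orth hu huc hu0 hlap hφ hφl hφ0
    rcases mul_eq_zero.mp this with h | h
    · linarith
    · exact absurd h hintne
  refine ⟨R a b c d, hφ.continuous.continuousOn, hφ.contDiffOn, ?_, ?_, ?_⟩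
  · intro p hp
    apply hR
    rcases frontier_hex hp with (h | h | h) | (h | h | h)
    · exact D_zero_cs (k := -1) (by simpa using h) a b c
    · exact D_zero_cr (k := -1) (by simpa using h) a b c
    · exact D_zero_sum (k := 1) (by simpa using h) a b c
    · exact D_zero_cs (k := 1) (by simpa using h) a b c
    · exact D_zero_cr (k := 1) (by simpa using h) a b c
    · exact D_zero_sum (k := -1) (by simpa using h) a b c
  · by_contra! hne
    apply hintne
    rw [setIntegral_congr_fun (g := fun _ => (0 : ℝ)) measurableSet_triK]
    · simp
    · intro p hp
      show u p * R a b c d p = 0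
      by_cases hpE : p ∈ equilateralTriangle
      · rw [hne p (equi_sub_hex hpE), mul_zero]
      · rw [hφ0 p ⟨hp, hpE⟩, mul_zero]
  · intro p _
    rw [← hmu]
    exact hφl p

end Complete

theorem stmt5 (lam : ℝ) (h : IsDirichletEigenvalue equilateralTriangle lam) :
    IsDirichletEigenvalue hexagram lam := by
  obtain ⟨u, huc, hu, hu0, ⟨p, hp, hup⟩, hlap⟩ := h
  rw [closure_equi] at huc
  rw [frontier_equi] at hu0
  by_contra hcon
  apply hup
  refine complete huc (fun a b c => ?_) p hp
  have hi : MeasureTheory.IntegrableOn (fun p => (u p : ℂ) * D a b c p) triK :=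
    ((Complex.continuous_ofReal.comp_continuousOn huc).mul
      (D_continuous a b c).continuousOn).integrableOn_compact isCompact_triK
  apply Complex.ext
  · by_contra hne
    refine hcon (final_aux (a := a) (b := b) (c := c) (d := 0) huc hu hu0 hlap ?_ ?_)
    · intro q hq
      rw [← D_re, hq, Complex.zero_re]
    · intro h0
      apply hne
      have := Complex.reCLM.integral_comp_comm hi
      simp only [Complex.reCLM_apply, Complex.re_ofReal_mul, D_re] at this
      rw [← this, h0, Complex.zero_re]
  · by_contra hne
    refine hcon (final_aux (a := a) (b := b) (c := c) (d := -(Real.pi / 2)) huc hu hu0 hlap ?_ ?_)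
    · intro q hq
      rw [← D_im, hq, Complex.zero_im]
    · intro h0
      apply hne
      have := Complex.imCLM.integral_comp_comm hi
      simp only [Complex.imCLM_apply, Complex.im_ofReal_mul, D_im] at this
      rw [← this, h0, Complex.zero_im]
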